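/- arXiv:1605.09255 — 3 statements merged into one kernel-verified Lean document; each statement's English description precedes it below -/
import Mathlib

section
/- Let P be a 2-term silting complex in K^b(proj A). Then the pair (T(P), F(P)) is a torsion pair in mod A; that is, a finitely generated A-module M satisfies Hom_A(X, M) = 0 for all X in T(P) if and only if M is in F(P), and M satisfies Hom_A(M, Y) = 0 for all Y in F(P) if and only if M is in T(P). -/
/-!
Common setup: we model right `A`-modules as `ModuleCat Aᵐᵒᵖ`, the bounded derived
category `D^b(mod A)` as the full subcategory (given by the predicate `InDb`) of the
derived category of `Mod Aᵐᵒᵖ` consisting of cohomologically bounded complexes with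
finitely generated cohomology, and `K^b(proj A)` via bounded complexes of finitely
generated projective modules (`IsPerfCplx`).
-/

namespace TwoTermSilting

open CategoryTheory Limits Pretriangulated

universe w v u

noncomputable section

/-- The projective dimension of the module `M` is at most `n`. -/
def pdLE (R : Type u) [Ring R] : ℕ → ModuleCat.{v} R → Prop
  | 0, M => Projective M
  | (n+1), M => ∃ (P : ModuleCat.{v} R) (f : P ⟶ M),
      Projective P ∧ Epi f ∧ pdLE R n (kernel f)

/-- The (right) global dimension of `R` is at most `d`: every finitely generated
module has projective dimension at most `d`. -/
def gldLE (R : Type u) [Ring R] (d : ℕ) : Prop :=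
  ∀ M : ModuleCat.{v} R, Module.Finite R M → pdLE R d M

section Star

variable {C : Type u} [Category.{v} C] [HasZeroObject C] [Preadditive C] [HasShift C ℤ]
  [∀ n : ℤ, (shiftFunctor C n).Additive] [Pretriangulated C]

/-- `star S T` consists of the objects `Z` sitting in a distinguished triangle
`X ⟶ Z ⟶ Y ⟶ X⟦1⟧` with `X ∈ S` and `Y ∈ T`. -/
def star (S T : Set C) : Set C :=
  {Z | ∃ (X Y : C) (f : X ⟶ Z) (g : Z ⟶ Y) (h : Y ⟶ X⟦(1 : ℤ)⟧),
    X ∈ S ∧ Y ∈ T ∧ Triangle.mk f g h ∈ distTriang C}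

/-- `starChain f n` is the iterated star product `f 0 * f 1 * ⋯ * f n`
(the star operation being associative). -/
def starChain (f : ℕ → Set C) : ℕ → Set C
  | 0 => f 0
  | (n+1) => star (starChain f n) (f (n+1))

/-- The closure of a class of objects under the shift by `n`. -/
def shiftSet (S : Set C) (n : ℤ) : Set C :=
  {Y | ∃ X ∈ S, Nonempty (Y ≅ X⟦n⟧)}

/-- The additive closure of the object `X`: all direct summands of finite direct sums
of copies of `X`. -/
def addOf (X : C) : Set C :=
  {Y | ∃ (n : ℕ) (ι : Y ⟶ ⨁ (fun _ : Fin n => X)) (r : (⨁ (fun _ : Fin n => X)) ⟶ Y),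
    ι ≫ r = 𝟙 Y}

/-- A class of objects of a (pre)triangulated category is thick if it is closed under
isomorphisms, shifts, extensions and direct summands. -/
def IsThick (S : Set C) : Prop :=
  (∀ ⦃X Y : C⦄, (X ≅ Y) → X ∈ S → Y ∈ S) ∧
  (∀ (X : C) (n : ℤ), X ∈ S → (X⟦n⟧) ∈ S) ∧
  (∀ T : Triangle C, (T ∈ distTriang C) → T.obj₁ ∈ S → T.obj₃ ∈ S → T.obj₂ ∈ S) ∧
  (∀ (X Y : C) (ι : X ⟶ Y) (r : Y ⟶ X), ι ≫ r = 𝟙 X → Y ∈ S → X ∈ S)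

end Star

/-- The right `End Y`-module structure on `Y ⟶ X`, by precomposition. -/
instance endModule {C : Type u} [Category.{v} C] [Preadditive C] (Y X : C) :
    Module (End Y)ᵐᵒᵖ (Y ⟶ X) where
  smul b f := b.unop ≫ f
  one_smul f := Category.id_comp f
  mul_smul b₁ b₂ f := by
    show (b₁ * b₂).unop ≫ f = b₁.unop ≫ (b₂.unop ≫ f)
    have h : (b₁ * b₂).unop = b₁.unop ≫ b₂.unop := rfl
    rw [h, Category.assoc]
  smul_zero b := Limits.comp_zero
  smul_add b f g := Preadditive.comp_add _ _ _ _ _ _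
  add_smul b₁ b₂ f := Preadditive.add_comp _ _ _ _ _ _
  zero_smul f := Limits.zero_comp

section Main

variable (R : Type) [Ring R] [HasDerivedCategory.{w} (ModuleCat.{0} R)]

/-- A bounded complex of finitely generated projective modules
(an object of `K^b(proj R)`). -/
def IsPerfCplx (X : CochainComplex (ModuleCat.{0} R) ℤ) : Prop :=
  (∀ i, Projective (X.X i)) ∧ (∀ i, Module.Finite R (X.X i)) ∧
    ∃ a b : ℤ, ∀ i, (i < a ∨ b < i) → IsZero (X.X i)

/-- A complex of finitely generated projective modules concentrated in
degrees `-1` and `0`. -/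
def IsTwoTermCplx (X : CochainComplex (ModuleCat.{0} R) ℤ) : Prop :=
  (∀ i, Projective (X.X i)) ∧ (∀ i, Module.Finite R (X.X i)) ∧
    ∀ i, i ≠ -1 → i ≠ 0 → IsZero (X.X i)

/-- A two-term silting complex: a two-term complex of finitely generated projectives `P`
with `Hom_D(P, P[1]) = 0`, such that the smallest thick subcategory containing `P`
contains all of `K^b(proj R)`. -/
def IsTwoTermSilting (P : CochainComplex (ModuleCat.{0} R) ℤ) : Prop :=
  IsTwoTermCplx R P ∧
  (∀ f : DerivedCategory.Q.obj P ⟶ (DerivedCategory.Q.obj P)⟦(1 : ℤ)⟧, f = 0) ∧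
  (∀ S : Set (DerivedCategory (ModuleCat.{0} R)), IsThick S →
    DerivedCategory.Q.obj P ∈ S →
    ∀ X : CochainComplex (ModuleCat.{0} R) ℤ, IsPerfCplx R X → DerivedCategory.Q.obj X ∈ S)

/-- The objects of the derived category which belong to `D^b(mod R)`: cohomologically
bounded complexes with finitely generated cohomology. -/
def InDb (X : DerivedCategory (ModuleCat.{0} R)) : Prop :=
  (∃ a b : ℤ, ∀ i, (i < a ∨ b < i) →
    IsZero ((DerivedCategory.homologyFunctor (ModuleCat.{0} R) i).obj X)) ∧
  (∀ i : ℤ, Module.Finite R ((DerivedCategory.homologyFunctor (ModuleCat.{0} R) i).obj X))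

variable {R}

/-- The torsion class `T(P)` of finitely generated modules `X` with `Hom_D(P, X[1]) = 0`. -/
def TT (P : CochainComplex (ModuleCat.{0} R) ℤ) : Set (ModuleCat.{0} R) :=
  {X | Module.Finite R X ∧
    ∀ f : DerivedCategory.Q.obj P ⟶
      ((DerivedCategory.singleFunctor (ModuleCat.{0} R) 0).obj X)⟦(1 : ℤ)⟧, f = 0}

/-- The torsion-free class `F(P)` of finitely generated modules `Y` with `Hom_D(P, Y) = 0`. -/
def FF (P : CochainComplex (ModuleCat.{0} R) ℤ) : Set (ModuleCat.{0} R) :=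
  {Y | Module.Finite R Y ∧
    ∀ f : DerivedCategory.Q.obj P ⟶
      (DerivedCategory.singleFunctor (ModuleCat.{0} R) 0).obj Y, f = 0}

/-- The heart `C(P) = {X ∈ D^b(mod R) | Hom_D(P, X[i]) = 0 for all i ≠ 0}`. -/
def CP (P : CochainComplex (ModuleCat.{0} R) ℤ) : Set (DerivedCategory (ModuleCat.{0} R)) :=
  {X | InDb R X ∧ ∀ i : ℤ, i ≠ 0 → ∀ f : DerivedCategory.Q.obj P ⟶ X⟦i⟧, f = 0}

end Main

section Derived

variable {C : Type u} [Category.{v} C] [Abelian C] [HasDerivedCategory.{w} C]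

/-- For `K` K-projective, `Hom_D(K, L[n])` vanishes if and only if every `n`-cocycle of the
Hom complex from `K` to `L` is a coboundary. -/
lemma hom_shift_eq_zero_iff (K L : CochainComplex C ℤ) [K.IsKProjective] (n : ℤ) :
    (∀ f : DerivedCategory.Q.obj K ⟶ (DerivedCategory.Q.obj L)⟦n⟧, f = 0) ↔
      ∀ z : CochainComplex.HomComplex.Cocycle K L n,
        z ∈ CochainComplex.HomComplex.coboundaries K L n := by
  let e : (DerivedCategory.Q.obj L)⟦n⟧ ≅
      DerivedCategory.Qh.obj ((HomotopyCategory.quotient _ _).obj (L⟦n⟧)) :=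
    (DerivedCategory.Q.commShiftIso n).symm.app L ≪≫
      (DerivedCategory.quotientCompQhIso C).symm.app (L⟦n⟧)
  let e' := (DerivedCategory.quotientCompQhIso C).app K
  have hbij := CochainComplex.IsKProjective.Qh_map_bijective K
    ((HomotopyCategory.quotient _ _).obj (L⟦n⟧))
  constructor
  · intro h z
    rw [← CochainComplex.HomComplex.CohomologyClass.toHom_mk_eq_zero_iff]
    apply hbij.injective
    rw [Functor.map_zero]
    have h' := h (e'.inv ≫ DerivedCategory.Qh.map
      (CochainComplex.HomComplex.CohomologyClass.toHom
        (CochainComplex.HomComplex.CohomologyClass.mk z)) ≫ e.inv)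
    simpa only [Preadditive.IsIso.comp_left_eq_zero, Preadditive.IsIso.comp_right_eq_zero] using h'
  · intro h f
    obtain ⟨g, hg⟩ := hbij.surjective (e'.hom ≫ f ≫ e.hom)
    obtain ⟨c, rfl⟩ :=
      (CochainComplex.HomComplex.CohomologyClass.toHom_bijective K L n).surjective g
    obtain ⟨z, rfl⟩ := c.mk_surjective
    rw [(CochainComplex.HomComplex.CohomologyClass.toHom_mk_eq_zero_iff z).2 (h z),
      Functor.map_zero] at hg
    simpa only [Preadditive.IsIso.comp_left_eq_zero, Preadditive.IsIso.comp_right_eq_zero] using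
      hg.symm

/-- For `K` K-projective, `Hom_D(K, X[n])` vanishes for `X` an object of the abelian category if
and only if `Hom(K, X)` is exact at the component of degree `-n`. -/
lemma hom_single_shift_eq_zero_iff (K : CochainComplex C ℤ) [K.IsKProjective] (X : C)
    (n p' p p'' : ℤ) (hp : p + n = 0) (hp' : p' + 1 = p) (hp'' : p + 1 = p'') :
    (∀ f : DerivedCategory.Q.obj K ⟶ ((DerivedCategory.singleFunctor C 0).obj X)⟦n⟧, f = 0) ↔
      ∀ φ : K.X p ⟶ X, K.d p' p ≫ φ = 0 → ∃ g : K.X p'' ⟶ X, K.d p p'' ≫ g = φ := by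
  refine (hom_shift_eq_zero_iff K ((CochainComplex.singleFunctor C 0).obj X) n).trans ?_
  constructor
  · intro h φ hφ
    exact (CochainComplex.HomComplex.Cocycle.toSingleMk_mem_coboundaries_iff
      φ hp p' hp' hφ p'' hp'').1 (h _)
  · intro h z
    obtain ⟨φ, hφ, rfl⟩ :=
      CochainComplex.HomComplex.Cocycle.toSingleMk_surjective z p hp p' hp'
    exact (CochainComplex.HomComplex.Cocycle.toSingleMk_mem_coboundaries_iff
      φ hp p' hp' hφ p'' hp'').2 (h φ hφ)

end Derived

section Orthogonal

variable {C : Type u} [Category.{v} C] [HasZeroObject C] [Preadditive C] [HasShift C ℤ]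
  [∀ n : ℤ, (shiftFunctor C n).Additive] [Pretriangulated C]

/-- The objects with no nonzero morphism to any shift of `L` form a thick class. -/
lemma isThick_orthogonal (L : C) :
    IsThick {Y : C | ∀ (n : ℤ) (f : Y ⟶ L⟦n⟧), f = 0} := by
  refine ⟨fun X Y e hX n f ↦ ?_, fun X m hX n f ↦ ?_, fun T hT h₁ h₃ n f ↦ ?_,
    fun X Y i r hir hY n f ↦ ?_⟩
  · rw [← cancel_epi e.hom, comp_zero]
    exact hX n _
  · apply (shiftFunctor C (-m)).map_injective
    rw [Functor.map_zero, ← cancel_epi ((shiftFunctorCompIsoId C m (-m) (by lia)).inv.app X),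
      ← cancel_mono ((shiftFunctorAdd' C n (-m) (n - m) (by lia)).inv.app L), comp_zero, zero_comp]
    exact hX _ _
  · obtain ⟨g, rfl⟩ := Triangle.yoneda_exact₂ T hT f (h₁ n _)
    rw [h₃ n g, comp_zero]
  · rw [← Category.id_comp f, ← hir, Category.assoc, hY n (r ≫ f), comp_zero]

end Orthogonal

section Torsion

variable {C : Type u} [Category.{v} C] {K₁ K₀ : C} {d : K₁ ⟶ K₀}

/-- Every morphism from the source of `d` to `X` extends along `d`. -/
def IsTorsion (d : K₁ ⟶ K₀) (X : C) : Prop := ∀ φ : K₁ ⟶ X, ∃ g : K₀ ⟶ X, d ≫ g = φ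

lemma IsTorsion.of_epi [Projective K₁] {X Y : C} (h : IsTorsion d X) (p : X ⟶ Y) [Epi p] :
    IsTorsion d Y := by
  intro φ
  obtain ⟨g, hg⟩ := h (Projective.factorThru φ p)
  exact ⟨g ≫ p, by rw [reassoc_of% hg, Projective.factorThru_comp]⟩

variable [Abelian C]

/-- Every morphism to `Y` from the target of `d` which vanishes on `d` is zero. -/
def IsTorsionFree (d : K₁ ⟶ K₀) (Y : C) : Prop := ∀ f : K₀ ⟶ Y, d ≫ f = 0 → f = 0

lemma IsTorsionFree.of_mono {X Y : C} (h : IsTorsionFree d Y) (i : X ⟶ Y) [Mono i] :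
    IsTorsionFree d X := by
  intro f hf
  rw [← cancel_mono i, zero_comp]
  exact h _ (by rw [reassoc_of% hf, zero_comp])

lemma IsTorsion.of_exact [Projective K₁] [Projective K₀] {S : ShortComplex C} (hS : S.Exact)
    [Epi S.g] (h₁ : IsTorsion d S.X₁) (h₃ : IsTorsion d S.X₃) : IsTorsion d S.X₂ := by
  intro φ
  obtain ⟨g, hg⟩ := h₃ (φ ≫ S.g)
  have h : (φ - d ≫ Projective.factorThru g S.g) ≫ S.g = 0 := by simp [hg]
  obtain ⟨t, ht⟩ := h₁ (hS.liftFromProjective _ h)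
  refine ⟨Projective.factorThru g S.g + t ≫ S.f, ?_⟩
  rw [Preadditive.comp_add, reassoc_of% ht, hS.liftFromProjective_comp, add_sub_cancel]

/-- If every endomorphism of degree `1` of the two-term complex `d` is null-homotopic, every
quotient of the cokernel of `d` is torsion. -/
lemma isTorsion_of_comp_eq_zero [Projective K₁]
    (hd : ∀ φ : K₁ ⟶ K₀, ∃ (t : K₁ ⟶ K₁) (s : K₀ ⟶ K₀), t ≫ d + d ≫ s = φ)
    {X : C} (p : K₀ ⟶ X) [Epi p] (hp : d ≫ p = 0) : IsTorsion d X := by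
  intro φ
  obtain ⟨t, s, h⟩ := hd (Projective.factorThru φ p)
  refine ⟨s ≫ p, ?_⟩
  rw [← Projective.factorThru_comp φ p, ← h]
  simp [hp]

lemma IsTorsion.hom_eq_zero [Projective K₁]
    (h₀ : ∀ X : C, IsTorsion d X → IsTorsionFree d X → IsZero X)
    {X Y : C} (hX : IsTorsion d X) (hY : IsTorsionFree d Y) (g : X ⟶ Y) : g = 0 := by
  have h := h₀ (Abelian.image g) (hX.of_epi (Abelian.factorThruImage g))
    (hY.of_mono (Abelian.image.ι g))
  rw [← Abelian.image.fac g, h.eq_of_src (Abelian.image.ι g) 0, comp_zero]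

end Torsion

section Module

variable {R : Type u} [Ring R] {K₁ K₀ : ModuleCat.{v} R} {d : K₁ ⟶ K₀}

/-- The extension of a submodule by a torsion submodule of the quotient is torsion. -/
lemma isTorsion_comap_mkQ [Projective K₁] [Projective K₀] {M : Type v} [AddCommGroup M]
    [Module R M] (N : Submodule R M) (I : Submodule R (M ⧸ N))
    (hN : IsTorsion d (ModuleCat.of R N)) (hI : IsTorsion d (ModuleCat.of R I)) :
    IsTorsion d (ModuleCat.of R (I.comap N.mkQ)) := by
  let p : I.comap N.mkQ →ₗ[R] I := N.mkQ.restrict fun _ hx ↦ hx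
  let i : N →ₗ[R] I.comap N.mkQ := Submodule.inclusion (N.le_comap_mkQ I)
  have hip : p ∘ₗ i = 0 := by
    ext x
    simp [p, i]
  let S : ShortComplex (ModuleCat.{v} R) :=
    ShortComplex.mk (ModuleCat.ofHom i) (ModuleCat.ofHom p)
      (by rw [← ModuleCat.ofHom_comp, hip]; rfl)
  have hS : S.Exact := by
    rw [ShortComplex.moduleCat_exact_iff]
    rintro ⟨x, hx⟩ h
    have h' : N.mkQ x = 0 := congrArg Subtype.val h
    exact ⟨⟨x, by simpa using h'⟩, rfl⟩
  have : Epi S.g := by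
    rw [ModuleCat.epi_iff_surjective]
    rintro ⟨y, hy⟩
    obtain ⟨x, rfl⟩ := N.mkQ_surjective y
    exact ⟨⟨x, hy⟩, rfl⟩
  exact IsTorsion.of_exact hS hN hI

lemma isTorsion_range [Projective K₁]
    (hd : ∀ φ : K₁ ⟶ K₀, ∃ (t : K₁ ⟶ K₁) (s : K₀ ⟶ K₀), t ≫ d + d ≫ s = φ)
    {X : ModuleCat.{v} R} (f : K₀ ⟶ X) (hf : d ≫ f = 0) :
    IsTorsion d (ModuleCat.of R (LinearMap.range f.hom)) := by
  have : Epi (ModuleCat.ofHom f.hom.rangeRestrict) := by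
    rw [ModuleCat.epi_iff_surjective]
    exact f.hom.surjective_rangeRestrict
  refine isTorsion_of_comp_eq_zero hd (ModuleCat.ofHom f.hom.rangeRestrict) ?_
  refine ModuleCat.hom_ext (LinearMap.ext fun x ↦ Subtype.ext ?_)
  exact ConcreteCategory.congr_hom hf x

/-- A noetherian module has a torsion submodule whose quotient is torsion free. -/
lemma exists_isTorsion_isTorsionFree [Projective K₁] [Projective K₀]
    (hd : ∀ φ : K₁ ⟶ K₀, ∃ (t : K₁ ⟶ K₁) (s : K₀ ⟶ K₀), t ≫ d + d ≫ s = φ)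
    (M : Type v) [AddCommGroup M] [Module R M] [IsNoetherian R M] :
    ∃ N : Submodule R M, IsTorsion d (ModuleCat.of R N) ∧
      IsTorsionFree d (ModuleCat.of R (M ⧸ N)) := by
  obtain ⟨N, hN, hmax⟩ := set_has_maximal_iff_noetherian.2 ‹IsNoetherian R M›
    {N : Submodule R M | IsTorsion d (ModuleCat.of R N)}
    ⟨⊥, fun φ ↦ ⟨0, (ModuleCat.isZero_of_subsingleton
      (ModuleCat.of R (⊥ : Submodule R M))).eq_of_tgt _ _⟩⟩
  refine ⟨N, hN, fun f hf ↦ ?_⟩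
  have h := hmax _ (isTorsion_comap_mkQ N _ hN (isTorsion_range hd f hf))
  have h' := (N.le_comap_mkQ (LinearMap.range f.hom)).eq_of_not_lt h
  ext x
  obtain ⟨y, hy⟩ := N.mkQ_surjective (f.hom x)
  have hyN : y ∈ N := by
    rw [h']
    exact ⟨x, hy.symm⟩
  have hy' : N.mkQ y = 0 := by simpa using hyN
  exact hy.symm.trans hy'

end Module

section TwoTerm

variable {R : Type} [Ring R] {P : CochainComplex (ModuleCat.{0} R) ℤ}

lemma IsTwoTermCplx.isKProjective (hP : IsTwoTermCplx R P) : P.IsKProjective := by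
  have := hP.1
  have : P.IsStrictlyLE 0 := by
    rw [CochainComplex.isStrictlyLE_iff]
    exact fun i hi ↦ hP.2.2 i (by lia) (by lia)
  exact CochainComplex.isKProjective_of_projective P 0

variable [HasDerivedCategory.{w} (ModuleCat.{0} R)]

lemma mem_TT_iff (hP : IsTwoTermCplx R P) (X : ModuleCat.{0} R) :
    X ∈ TT P ↔ Module.Finite R X ∧ IsTorsion (P.d (-1) 0) X := by
  have := hP.isKProjective
  refine and_congr_right fun _ ↦ ?_
  rw [hom_single_shift_eq_zero_iff P X 1 (-2) (-1) 0 (by lia) (by lia) (by lia)]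
  exact ⟨fun h φ ↦ h φ ((hP.2.2 (-2) (by lia) (by lia)).eq_of_src _ _), fun h φ _ ↦ h φ⟩

lemma mem_FF_iff (hP : IsTwoTermCplx R P) (Y : ModuleCat.{0} R) :
    Y ∈ FF P ↔ Module.Finite R Y ∧ IsTorsionFree (P.d (-1) 0) Y := by
  have := hP.isKProjective
  refine and_congr_right fun _ ↦ ?_
  let L := (DerivedCategory.singleFunctor (ModuleCat.{0} R) 0).obj Y
  let e : L⟦(0 : ℤ)⟧ ≅ L := (shiftFunctorZero _ ℤ).app L
  have h₁ : (∀ f : DerivedCategory.Q.obj P ⟶ L, f = 0) ↔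
      ∀ f : DerivedCategory.Q.obj P ⟶ L⟦(0 : ℤ)⟧, f = 0 := by
    constructor
    · intro h f
      rw [← cancel_mono e.hom, h (f ≫ e.hom), zero_comp]
    · intro h f
      rw [← cancel_mono e.inv, h (f ≫ e.inv), zero_comp]
  rw [h₁, hom_single_shift_eq_zero_iff P Y 0 (-1) 0 1 (by lia) (by lia) (by lia)]
  refine forall₂_congr fun φ _ ↦ ?_
  rw [(hP.2.2 1 (by lia) (by lia)).eq_of_tgt (P.d 0 1) 0]
  exact ⟨fun ⟨_, hg⟩ ↦ by rw [← hg, zero_comp], fun h ↦ ⟨0, by rw [h, comp_zero]⟩⟩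

lemma IsTwoTermSilting.exists_homotopy (hP : IsTwoTermSilting R P) (φ : P.X (-1) ⟶ P.X 0) :
    ∃ (t : P.X (-1) ⟶ P.X (-1)) (s : P.X 0 ⟶ P.X 0),
      t ≫ P.d (-1) 0 + P.d (-1) 0 ≫ s = φ := by
  have := hP.1.isKProjective
  let c : CochainComplex.HomComplex.Cochain P P 1 := CochainComplex.HomComplex.Cochain.single φ 1
  have hc : CochainComplex.HomComplex.δ 1 2 c = 0 := by
    ext p q hpq : 1
    by_cases hp : p = -1
    · exact (hP.1.2.2 q (by lia) (by lia)).eq_of_tgt _ _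
    · by_cases hp' : p = 0
      · exact (hP.1.2.2 q (by lia) (by lia)).eq_of_tgt _ _
      · exact (hP.1.2.2 p hp hp').eq_of_src _ _
  obtain ⟨α, hα⟩ := (CochainComplex.HomComplex.mem_coboundaries_iff _ 0 (by lia)).1
    ((hom_shift_eq_zero_iff P P 1).1 hP.2.1
      (CochainComplex.HomComplex.Cocycle.mk c 2 (by lia) hc))
  have h := CochainComplex.HomComplex.Cochain.congr_v hα (-1) 0 (by lia)
  rw [CochainComplex.HomComplex.δ_v 0 1 (by lia) α (-1) 0 (by lia) (-1) 0 (by lia) (by lia)] at h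
  refine ⟨α.v (-1) (-1) (by lia), -α.v 0 0 (by lia), ?_⟩
  simpa [c] using h

/-- A module with no nonzero morphism from any shift of a silting complex is zero. -/
lemma IsTwoTermSilting.isZero (hP : IsTwoTermSilting R P) (X : ModuleCat.{0} R)
    (hT : IsTorsion (P.d (-1) 0) X) (hF : IsTorsionFree (P.d (-1) 0) X) : IsZero X := by
  have := hP.1.isKProjective
  let L := (DerivedCategory.singleFunctor (ModuleCat.{0} R) 0).obj X
  have hPL : ∀ (n : ℤ) (f : DerivedCategory.Q.obj P ⟶ L⟦n⟧), f = 0 := by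
    intro n
    rw [hom_single_shift_eq_zero_iff P X n (-n - 1) (-n) (-n + 1) (by lia) (by lia) (by lia)]
    intro φ hφ
    by_cases h₀ : n = 0
    · obtain rfl := h₀
      exact ⟨0, by rw [comp_zero]; exact (hF φ hφ).symm⟩
    · by_cases h₁ : n = 1
      · obtain rfl := h₁
        exact hT φ
      · exact ⟨0, (hP.1.2.2 (-n) (by lia) (by lia)).eq_of_src _ _⟩
  let F : ModuleCat.{0} R := ModuleCat.of R R
  let S : CochainComplex (ModuleCat.{0} R) ℤ := (HomologicalComplex.single _ _ 0).obj F
  let e : S.X 0 ≅ F := HomologicalComplex.singleObjXSelf (.up ℤ) 0 F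
  have hz : ∀ i : ℤ, i ≠ 0 → IsZero (S.X i) := fun i hi ↦
    HomologicalComplex.isZero_single_obj_X _ _ _ _ hi
  have hFproj : Projective F := ModuleCat.projective_of_categoryTheory_projective F
  have hS : IsPerfCplx R S := by
    refine ⟨fun i ↦ ?_, fun i ↦ ?_, 0, 0, fun i hi ↦ hz i (by lia)⟩
    · by_cases hi : i = 0
      · obtain rfl := hi
        exact Projective.of_iso e.symm hFproj
      · exact (hz i hi).projective
    · by_cases hi : i = 0
      · obtain rfl := hi
        exact Module.Finite.equiv e.symm.toLinearEquiv
      · have := ModuleCat.subsingleton_of_isZero (hz i hi)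
        infer_instance
  have hSL := hP.2.2 _ (isThick_orthogonal L) hPL S hS
  rw [IsZero.iff_id_eq_zero]
  ext x
  have hx : ModuleCat.ofHom (LinearMap.toSpanSingleton R X x) = 0 := by
    apply (DerivedCategory.singleFunctor (ModuleCat.{0} R) 0).map_injective
    rw [Functor.map_zero, ← cancel_mono
      ((shiftFunctorZero (DerivedCategory (ModuleCat.{0} R)) ℤ).inv.app L), zero_comp]
    exact hSL 0 _
  simpa using ConcreteCategory.congr_hom hx (1 : R)

end TwoTerm

/-- For a 2-term silting complex `P` in `K^b(proj A)`, the pair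
`(T(P), F(P))` is a torsion pair in `mod A`: a finitely generated module `M` is
right-orthogonal to `T(P)` iff `M ∈ F(P)`, and left-orthogonal to `F(P)` iff `M ∈ T(P)`. -/
theorem torsionPair_TT_FF
    (k A : Type) [Field k] [Ring A] [Algebra k A] [FiniteDimensional k A]
    [HasDerivedCategory.{w} (ModuleCat.{0} Aᵐᵒᵖ)]
    (P : CochainComplex (ModuleCat.{0} Aᵐᵒᵖ) ℤ)
    (hP : IsTwoTermSilting Aᵐᵒᵖ P)
    (M : ModuleCat.{0} Aᵐᵒᵖ) (hM : Module.Finite Aᵐᵒᵖ M) :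
    ((∀ X ∈ TT P, ∀ g : X ⟶ M, g = 0) ↔ M ∈ FF P) ∧
    ((∀ Y ∈ FF P, ∀ g : M ⟶ Y, g = 0) ↔ M ∈ TT P) := by
  have : Projective (P.X (-1)) := hP.1.1 _
  have : Projective (P.X 0) := hP.1.1 _
  have hfin₀ : Module.Finite Aᵐᵒᵖ (P.X 0) := hP.1.2.1 0
  have : IsNoetherianRing Aᵐᵒᵖ := isNoetherian_of_tower k inferInstance
  have hhom : ∀ X ∈ TT P, ∀ Y ∈ FF P, ∀ g : X ⟶ Y, g = 0 := fun X hX Y hY ↦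
    ((mem_TT_iff hP.1 X).1 hX).2.hom_eq_zero hP.isZero ((mem_FF_iff hP.1 Y).1 hY).2
  refine ⟨⟨fun h ↦ (mem_FF_iff hP.1 M).2 ⟨hM, fun f hf ↦ ?_⟩, fun h X hX ↦ hhom X hX M h⟩,
    ⟨fun h ↦ (mem_TT_iff hP.1 M).2 ⟨hM, ?_⟩, fun h Y hY ↦ hhom M h Y hY⟩⟩
  · have h' := h (ModuleCat.of Aᵐᵒᵖ (LinearMap.range f.hom))
      ((mem_TT_iff hP.1 _).2 ⟨inferInstanceAs (Module.Finite Aᵐᵒᵖ (LinearMap.range f.hom)),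
        isTorsion_range hP.exists_homotopy f hf⟩)
      (ModuleCat.ofHom (LinearMap.range f.hom).subtype)
    ext x
    exact ConcreteCategory.congr_hom h' ⟨f.hom x, x, rfl⟩
  · obtain ⟨N, hN, hN'⟩ := exists_isTorsion_isTorsionFree hP.exists_homotopy M
    have h' := h (ModuleCat.of Aᵐᵒᵖ (M ⧸ N))
      ((mem_FF_iff hP.1 _).2 ⟨inferInstanceAs (Module.Finite Aᵐᵒᵖ (M ⧸ N)), hN'⟩)
      (ModuleCat.ofHom N.mkQ)
    have : Epi (ModuleCat.ofHom N.subtype) := by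
      rw [ModuleCat.epi_iff_surjective]
      intro x
      have hx : N.mkQ x = 0 := ConcreteCategory.congr_hom h' x
      exact ⟨⟨x, by simpa using hx⟩, rfl⟩
    exact hN.of_epi (ModuleCat.ofHom N.subtype)

end

end TwoTermSilting
end

section
/- Let P be a 2-term silting complex in K^b(proj A) and let X be an object of D = D^b(A). Then X lies in C(P) if and only if H^0(X) lies in T(P), H^{-1}(X) lies in F(P), and H^i(X) = 0 for all i ≠ -1, 0. -/
/-!
Common setup: we model right `A`-modules as `ModuleCat Aᵐᵒᵖ`, the bounded derived
category `D^b(mod A)` as the full subcategory (given by the predicate `InDb`) of the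
derived category of `Mod Aᵐᵒᵖ` consisting of cohomologically bounded complexes with
finitely generated cohomology, and `K^b(proj A)` via bounded complexes of finitely
generated projective modules (`IsPerfCplx`).
-/

namespace TwoTermSilting

open CategoryTheory Limits Pretriangulated

universe w v u

noncomputable section

section Orthogonality

variable {C : Type u} [Category.{v} C] [Abelian C]

lemma exists_lift_cycles (L : CochainComplex C ℤ) {T : C} [Projective T] {i j : ℤ}
    (hij : i + 1 = j) (g : T ⟶ L.homology i) :
    ∃ (z : T ⟶ L.X i) (hz : z ≫ L.d i j = 0),
      L.liftCycles z j (by simp [← hij]) hz ≫ L.homologyπ i = g := by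
  have h : (Projective.factorThru g (L.homologyπ i) ≫ L.iCycles i) ≫ L.d i j = 0 := by simp
  refine ⟨_, h, ?_⟩
  have : L.liftCycles _ j (by simp [← hij]) h = Projective.factorThru g (L.homologyπ i) := by
    simp [← cancel_mono (L.iCycles i)]
  rw [this, Projective.factorThru_comp]

lemma exists_lift_boundary (L : CochainComplex C ℤ) {T : C} [Projective T] {i j l : ℤ}
    (hij : i + 1 = j) (hjl : j + 1 = l) (z : T ⟶ L.X j) (hz : z ≫ L.d j l = 0)
    (h : L.liftCycles z l (by simp [← hjl]) hz ≫ L.homologyπ j = 0) :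
    ∃ y : T ⟶ L.X i, y ≫ L.d i j = z := by
  have hS : (ShortComplex.mk _ _ (L.toCycles_comp_homologyπ i j)).Exact :=
    ShortComplex.exact_of_g_is_cokernel _ (L.homologyIsCokernel i j (by simp [← hij]))
  refine ⟨hS.liftFromProjective _ h, ?_⟩
  have := hS.liftFromProjective_comp _ h
  dsimp at this
  rw [← L.toCycles_i, reassoc_of% this, L.liftCycles_i]

lemma liftCycles_homologyπ_eq_zero_of_eq (L : CochainComplex C ℤ) {T : C} {i j l : ℤ}
    (hjl : j + 1 = l) (z : T ⟶ L.X j) (hz : z ≫ L.d j l = 0)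
    (y : T ⟶ L.X i) (h : y ≫ L.d i j = z) :
    L.liftCycles z l (by simp [← hjl]) hz ≫ L.homologyπ j = 0 := by
  subst h
  have : L.liftCycles (y ≫ L.d i j) l (by simp [← hjl]) hz = y ≫ L.toCycles i j := by
    simp [← cancel_mono (L.iCycles j)]
  rw [this, Category.assoc, L.toCycles_comp_homologyπ, comp_zero]

/-- A morphism from a complex concentrated in degrees `-1` and `0`. -/
def twoTermHom (K L : CochainComplex C ℤ) (hK : ∀ i, i ≠ -1 → i ≠ 0 → IsZero (K.X i))
    (a : K.X (-1) ⟶ L.X (-1)) (b : K.X 0 ⟶ L.X 0)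
    (comm : a ≫ L.d (-1) 0 = K.d (-1) 0 ≫ b) (hb : b ≫ L.d 0 1 = 0) : K ⟶ L where
  f := Function.update (Function.update (fun _ ↦ 0) 0 b) (-1) a
  comm' i j hij := by
    obtain rfl : i + 1 = j := hij
    by_cases h₁ : i = -1
    · subst h₁
      simpa using comm
    · by_cases h₀ : i = 0
      · subst h₀
        simpa using hb
      · exact (hK i h₁ h₀).eq_of_src _ _

variable (K L : CochainComplex C ℤ)

lemma nonempty_homotopy_zero_of_twoTerm (hK : ∀ i, i ≠ -1 → i ≠ 0 → IsZero (K.X i))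
    (f : K ⟶ L) (s : K.X 0 ⟶ L.X (-1)) (t : K.X (-1) ⟶ L.X (-2))
    (h₀ : s ≫ L.d (-1) 0 = f.f 0)
    (h₁ : K.d (-1) 0 ≫ s + t ≫ L.d (-2) (-1) = f.f (-1)) :
    Nonempty (Homotopy f 0) := by
  let h : ∀ i j, (ComplexShape.up ℤ).Rel j i → (K.X i ⟶ L.X j) := fun i j hij ↦
    if hi : i = 0 then (K.XIsoOfEq hi).hom ≫ s ≫ (L.XIsoOfEq (by simp at hij; lia)).hom
    else if hi : i = -1 then (K.XIsoOfEq hi).hom ≫ t ≫ (L.XIsoOfEq (by simp at hij; lia)).hom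
    else 0
  have hf : f = Homotopy.nullHomotopicMap' h := by
    ext i
    have ha : (ComplexShape.up ℤ).Rel i (i + 1) := by simp
    have hb : (ComplexShape.up ℤ).Rel (i - 1) i := by simp
    rw [Homotopy.nullHomotopicMap'_f hb ha]
    by_cases hi₁ : i = -1
    · subst hi₁
      simpa [h] using h₁.symm
    · by_cases hi₀ : i = 0
      · subst hi₀
        have : K.d 0 1 = 0 := (hK 1 (by lia) (by lia)).eq_of_tgt _ _
        simpa [h, this] using h₀.symm
      · exact (hK i hi₁ hi₀).eq_of_src _ _
  rw [hf]
  exact ⟨Homotopy.nullHomotopy' h⟩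

lemma homotopy_zero_iff_of_twoTerm [∀ i, Projective (K.X i)]
    (hK : ∀ i, i ≠ -1 → i ≠ 0 → IsZero (K.X i)) :
    (∀ f : K ⟶ L, Nonempty (Homotopy f 0)) ↔
      (∀ g : K.X (-1) ⟶ L.homology (-1), ∃ h : K.X 0 ⟶ L.homology (-1), K.d (-1) 0 ≫ h = g) ∧
      (∀ h : K.X 0 ⟶ L.homology 0, K.d (-1) 0 ≫ h = 0 → h = 0) := by
  constructor
  · intro H
    refine ⟨fun g ↦ ?_, fun g hg ↦ ?_⟩
    · obtain ⟨z, hz, rfl⟩ := exists_lift_cycles L (j := 0) (by lia) g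
      obtain ⟨h⟩ := H (twoTermHom K L hK z 0 (by simpa using hz) (by simp))
      have e₀ := h.comm 0
      have e₁ := h.comm (-1)
      rw [dNext_eq _ (show (ComplexShape.up ℤ).Rel 0 1 by simp),
        prevD_eq _ (show (ComplexShape.up ℤ).Rel (-1) 0 by simp),
        (hK 1 (by lia) (by lia)).eq_of_tgt (K.d 0 1) 0] at e₀
      rw [dNext_eq _ (show (ComplexShape.up ℤ).Rel (-1) 0 by simp),
        prevD_eq _ (show (ComplexShape.up ℤ).Rel (-2) (-1) by simp)] at e₁
      simp [twoTermHom] at e₀ e₁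
      refine ⟨L.liftCycles (h.hom 0 (-1)) 0 (by simp) e₀.symm ≫ L.homologyπ _, ?_⟩
      rw [← sub_eq_zero, ← Category.assoc, ← Preadditive.sub_comp]
      have := liftCycles_homologyπ_eq_zero_of_eq L (j := -1) (l := 0) (by lia)
        (h.hom (-1) (-2) ≫ L.d (-2) (-1)) (by simp) (h.hom (-1) (-2)) rfl
      rw [← neg_eq_zero, ← Preadditive.neg_comp, ← this]
      congr 1
      simp [← cancel_mono (L.iCycles _), e₁]
    · obtain ⟨z, hz, rfl⟩ := exists_lift_cycles L (j := 1) (by lia) g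
      obtain ⟨y, hy⟩ := exists_lift_boundary L (i := -1) (j := 0) (l := 1) (by lia) (by lia)
        (K.d (-1) 0 ≫ z) (by simp [hz]) (by
          rw [← hg, ← Category.assoc (K.d (-1) 0) (L.liftCycles _ _ _ _)]
          congr 1
          simp [← cancel_mono (L.iCycles _)])
      obtain ⟨h⟩ := H (twoTermHom K L hK y z hy hz)
      have e₀ := h.comm 0
      rw [dNext_eq _ (show (ComplexShape.up ℤ).Rel 0 1 by simp),
        prevD_eq _ (show (ComplexShape.up ℤ).Rel (-1) 0 by simp),
        (hK 1 (by lia) (by lia)).eq_of_tgt (K.d 0 1) 0] at e₀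
      simp [twoTermHom] at e₀
      exact liftCycles_homologyπ_eq_zero_of_eq L (by lia) z hz _ e₀.symm
  · rintro ⟨H₁, H₀⟩ f
    have hf : f.f 0 ≫ L.d 0 1 = 0 := by
      rw [f.comm, (hK 1 (by lia) (by lia)).eq_of_tgt (K.d 0 1) 0, zero_comp]
    obtain ⟨s, hs⟩ := exists_lift_boundary L (i := -1) (by lia) (by lia) (f.f 0) hf (H₀ _ (by
      rw [← liftCycles_homologyπ_eq_zero_of_eq L (j := 0) (l := 1) (by lia)
        (K.d (-1) 0 ≫ f.f 0) (by simp [hf]) (f.f (-1)) (by simp), ← Category.assoc]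
      congr 1
      simp [← cancel_mono (L.iCycles _)]))
    have hu : (f.f (-1) - K.d (-1) 0 ≫ s) ≫ L.d (-1) 0 = 0 := by simp [hs]
    obtain ⟨w, hw⟩ := H₁ (L.liftCycles _ 0 (by simp) hu ≫ L.homologyπ _)
    obtain ⟨z, hz, rfl⟩ := exists_lift_cycles L (j := 0) (by lia) w
    obtain ⟨t, ht⟩ := exists_lift_boundary L (i := -2) (j := -1) (l := 0) (by lia) (by lia)
      (f.f (-1) - K.d (-1) 0 ≫ s - K.d (-1) 0 ≫ z) (by simp [hs, hz]) (by
        rw [← sub_eq_zero.2 hw.symm, ← Category.assoc (K.d (-1) 0) (L.liftCycles _ _ _ _),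
          ← Preadditive.sub_comp _ _ (L.homologyπ _)]
        congr 1
        simp [← cancel_mono (L.iCycles _)])
    refine nonempty_homotopy_zero_of_twoTerm K L hK f (s + z) t (by simp [hs, hz]) ?_
    rw [ht, Preadditive.comp_add]
    abel

variable [HasDerivedCategory.{w} C]

lemma Q_hom_eq_zero_iff_homotopy [K.IsKProjective] :
    (∀ f : DerivedCategory.Q.obj K ⟶ DerivedCategory.Q.obj L, f = 0) ↔
      ∀ f : K ⟶ L, Nonempty (Homotopy f 0) := by
  have hb := CochainComplex.IsKProjective.Qh_map_bijective K
    ((HomotopyCategory.quotient C (.up ℤ)).obj L)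
  constructor
  · intro H f
    refine ⟨HomotopyCategory.homotopyOfEq _ _ (hb.1 ?_)⟩
    have := H (DerivedCategory.Q.map f)
    rw [Functor.map_zero, Functor.map_zero]
    exact this
  · intro H f
    obtain ⟨g, hg⟩ := hb.2 f
    obtain ⟨g, rfl⟩ := (HomotopyCategory.quotient C (.up ℤ)).map_surjective g
    obtain ⟨h⟩ := H g
    rw [HomotopyCategory.eq_of_homotopy _ _ h, Functor.map_zero, Functor.map_zero] at hg
    exact hg.symm

variable {K}

lemma hom_eq_zero_iff_homology [∀ i, Projective (K.X i)]
    (hK : ∀ i, i ≠ -1 → i ≠ 0 → IsZero (K.X i)) (Y : DerivedCategory C)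
    {M N : C} (e₁ : (DerivedCategory.homologyFunctor C (-1)).obj Y ≅ M)
    (e₀ : (DerivedCategory.homologyFunctor C 0).obj Y ≅ N) :
    (∀ f : DerivedCategory.Q.obj K ⟶ Y, f = 0) ↔
      (∀ g : K.X (-1) ⟶ M, ∃ h : K.X 0 ⟶ M, K.d (-1) 0 ≫ h = g) ∧
      (∀ h : K.X 0 ⟶ N, K.d (-1) 0 ≫ h = 0 → h = 0) := by
  have : K.IsStrictlyLE 0 := by
    rw [CochainComplex.isStrictlyLE_iff]
    exact fun i hi ↦ hK i (by lia) (by lia)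
  have := CochainComplex.isKProjective_of_projective K 0
  obtain ⟨L, ⟨e⟩⟩ : ∃ L, Nonempty (DerivedCategory.Q.obj L ≅ Y) :=
    ⟨_, ⟨DerivedCategory.Q.objObjPreimageIso Y⟩⟩
  let e₁' : L.homology (-1) ≅ M := ((DerivedCategory.homologyFunctorFactors C (-1)).app L).symm ≪≫
    (DerivedCategory.homologyFunctor C (-1)).mapIso e ≪≫ e₁
  let e₀' : L.homology 0 ≅ N := ((DerivedCategory.homologyFunctorFactors C 0).app L).symm ≪≫
    (DerivedCategory.homologyFunctor C 0).mapIso e ≪≫ e₀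
  have hY : (∀ f : DerivedCategory.Q.obj K ⟶ Y, f = 0) ↔
      ∀ f : DerivedCategory.Q.obj K ⟶ DerivedCategory.Q.obj L, f = 0 :=
    ⟨fun H f ↦ by simpa using H (f ≫ e.hom), fun H f ↦ by simpa using H (f ≫ e.inv)⟩
  rw [hY, Q_hom_eq_zero_iff_homotopy, homotopy_zero_iff_of_twoTerm K L hK]
  refine and_congr ⟨fun H g ↦ ?_, fun H g ↦ ?_⟩ ⟨fun H h hh ↦ ?_, fun H h hh ↦ ?_⟩
  · obtain ⟨h, hh⟩ := H (g ≫ e₁'.inv)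
    exact ⟨h ≫ e₁'.hom, by simp [reassoc_of% hh]⟩
  · obtain ⟨h, hh⟩ := H (g ≫ e₁'.hom)
    exact ⟨h ≫ e₁'.inv, by simp [reassoc_of% hh]⟩
  · simpa using H (h ≫ e₀'.inv) (by simp [reassoc_of% hh])
  · simpa using H (h ≫ e₀'.hom) (by simp [reassoc_of% hh])

/-- The homology of a shifted object of the derived category. -/
def homologyShiftIso (Y : DerivedCategory C) (n i j : ℤ) (h : n + i = j) :
    (DerivedCategory.homologyFunctor C i).obj (Y⟦n⟧) ≅
      (DerivedCategory.homologyFunctor C j).obj Y :=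
  ((DerivedCategory.homologyFunctor C 0).shiftIso n i j h).app Y

lemma isZero_homology_single (M : C) (n : ℤ) (hn : n ≠ 0) :
    IsZero ((DerivedCategory.homologyFunctor C n).obj
      ((DerivedCategory.singleFunctor C 0).obj M)) :=
  (HomologicalComplex.isZero_single_obj_homology _ 0 M n hn).of_iso
    ((DerivedCategory.homologyFunctorFactors C n).app
      ((HomologicalComplex.single C (.up ℤ) 0).obj M))

/-- The homology in degree `0` of an object concentrated in degree `0`. -/
def homologySingleIso (M : C) :
    (DerivedCategory.homologyFunctor C 0).obj ((DerivedCategory.singleFunctor C 0).obj M) ≅ M :=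
  (DerivedCategory.singleFunctorCompHomologyFunctorIso C 0).app M

variable [∀ i, Projective (K.X i)]

lemma hom_single_eq_zero_iff (hK : ∀ i, i ≠ -1 → i ≠ 0 → IsZero (K.X i)) (M : C) :
    (∀ f : DerivedCategory.Q.obj K ⟶ (DerivedCategory.singleFunctor C 0).obj M, f = 0) ↔
      ∀ h : K.X 0 ⟶ M, K.d (-1) 0 ≫ h = 0 → h = 0 := by
  rw [hom_eq_zero_iff_homology hK _ (Iso.refl _) (homologySingleIso M)]
  exact and_iff_right fun g ↦ ⟨0, (isZero_homology_single M _ (by lia)).eq_of_tgt _ _⟩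

lemma hom_single_shift_eq_zero_iff_s7 (hK : ∀ i, i ≠ -1 → i ≠ 0 → IsZero (K.X i)) (M : C) :
    (∀ f : DerivedCategory.Q.obj K ⟶
      ((DerivedCategory.singleFunctor C 0).obj M)⟦(1 : ℤ)⟧, f = 0) ↔
      ∀ g : K.X (-1) ⟶ M, ∃ h : K.X 0 ⟶ M, K.d (-1) 0 ≫ h = g := by
  rw [hom_eq_zero_iff_homology hK _ (homologyShiftIso _ 1 (-1) 0 (by lia) ≪≫ homologySingleIso M)
    (homologyShiftIso _ 1 0 1 (by lia))]
  exact and_iff_left fun h _ ↦ (isZero_homology_single M _ (by lia)).eq_of_tgt _ _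

/-- The objects `Y⟦n⟧` receive no nonzero morphisms from a two-term complex `K` of projectives
iff `H^n(Y)` and `H^{n-1}(Y)` satisfy the corresponding orthogonality conditions. -/
lemma hom_shift_eq_zero_iff_s7 (hK : ∀ i, i ≠ -1 → i ≠ 0 → IsZero (K.X i))
    (Y : DerivedCategory C) (m n : ℤ) (hmn : m + 1 = n) :
    (∀ f : DerivedCategory.Q.obj K ⟶ Y⟦n⟧, f = 0) ↔
      (∀ f : DerivedCategory.Q.obj K ⟶ ((DerivedCategory.singleFunctor C 0).obj
        ((DerivedCategory.homologyFunctor C m).obj Y))⟦(1 : ℤ)⟧, f = 0) ∧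
      (∀ f : DerivedCategory.Q.obj K ⟶ (DerivedCategory.singleFunctor C 0).obj
        ((DerivedCategory.homologyFunctor C n).obj Y), f = 0) := by
  rw [hom_single_eq_zero_iff hK, hom_single_shift_eq_zero_iff_s7 hK]
  exact hom_eq_zero_iff_homology hK _ (homologyShiftIso Y n (-1) m (by lia))
    (homologyShiftIso Y n 0 n (by lia))

lemma hom_single_shift_eq_zero (hK : ∀ i, i ≠ -1 → i ≠ 0 → IsZero (K.X i)) (M : C)
    (h₀ : ∀ f : DerivedCategory.Q.obj K ⟶ (DerivedCategory.singleFunctor C 0).obj M, f = 0)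
    (h₁ : ∀ f : DerivedCategory.Q.obj K ⟶
      ((DerivedCategory.singleFunctor C 0).obj M)⟦(1 : ℤ)⟧, f = 0) (n : ℤ)
    (f : DerivedCategory.Q.obj K ⟶ ((DerivedCategory.singleFunctor C 0).obj M)⟦n⟧) : f = 0 := by
  by_cases hn₁ : n = 1
  · subst hn₁
    exact h₁ f
  by_cases hn₀ : n = 0
  · subst hn₀
    simpa using h₀ (f ≫ ((shiftFunctorZero _ ℤ).app _).hom)
  refine (hom_shift_eq_zero_iff_s7 hK _ (n - 1) n (by lia)).2
    ⟨fun g ↦ IsZero.eq_of_tgt ?_ _ _, fun g ↦ IsZero.eq_of_tgt ?_ _ _⟩ f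
  · exact Functor.map_isZero _ (Functor.map_isZero _ (isZero_homology_single M _ (by lia)))
  · exact Functor.map_isZero _ (isZero_homology_single M _ hn₀)

end Orthogonality

lemma isThick_leftOrthogonal {C : Type u} [Category.{v} C] [HasZeroObject C] [Preadditive C]
    [HasShift C ℤ] [∀ n : ℤ, (shiftFunctor C n).Additive] [Pretriangulated C] (M : C) :
    IsThick {Z : C | ∀ (n : ℤ) (f : Z ⟶ M⟦n⟧), f = 0} := by
  refine ⟨fun X Y e hX n f ↦ ?_, fun X m hX n f ↦ ?_, fun T hT h₁ h₃ n f ↦ ?_,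
    fun X Y ι r h hY n f ↦ ?_⟩
  · simpa using hX n (e.hom ≫ f)
  · let e := (shiftFunctorAdd' C (n - m) m n (by lia)).app M
    obtain ⟨g, hg⟩ := (shiftFunctor C m).map_surjective (f ≫ e.hom)
    rw [hX _ g, Functor.map_zero] at hg
    simpa using hg.symm
  · obtain ⟨g, rfl⟩ := Triangle.yoneda_exact₂ T hT f (h₁ n _)
    rw [h₃ n g, comp_zero]
  · rw [← Category.id_comp f, ← h, Category.assoc, hY n (r ≫ f), comp_zero]

lemma isZero_of_hom_silting_eq_zero {R : Type} [Ring R] [HasDerivedCategory.{w} (ModuleCat.{0} R)]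
    {P : CochainComplex (ModuleCat.{0} R) ℤ} (hP : IsTwoTermSilting R P) (M : ModuleCat.{0} R)
    (h₀ : ∀ f : DerivedCategory.Q.obj P ⟶
      (DerivedCategory.singleFunctor (ModuleCat.{0} R) 0).obj M, f = 0)
    (h₁ : ∀ f : DerivedCategory.Q.obj P ⟶
      ((DerivedCategory.singleFunctor (ModuleCat.{0} R) 0).obj M)⟦(1 : ℤ)⟧, f = 0) :
    IsZero M := by
  have := hP.1.1
  let A := (HomologicalComplex.single (ModuleCat.{0} R) (.up ℤ) 0).obj (ModuleCat.of R R)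
  have hz (i : ℤ) (hi : i ≠ 0) : IsZero (A.X i) :=
    HomologicalComplex.isZero_single_obj_X _ _ _ _ hi
  let e : A.X 0 ≅ ModuleCat.of R R := HomologicalComplex.singleObjXSelf _ _ _
  have hproj : Projective (ModuleCat.of R R) :=
    (IsProjective.iff_projective R).1 inferInstance
  have hA : IsPerfCplx R A := by
    refine ⟨fun i ↦ ?_, fun i ↦ ?_, 0, 0, fun i hi ↦ hz i (by lia)⟩
    · by_cases hi : i = 0
      · subst hi
        exact Projective.of_iso e.symm hproj
      · exact (hz i hi).projective
    · by_cases hi : i = 0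
      · subst hi
        exact Module.Finite.equiv e.symm.toLinearEquiv
      · have := ModuleCat.subsingleton_of_isZero (hz i hi)
        infer_instance
  have hAM := hP.2.2 _ (isThick_leftOrthogonal ((DerivedCategory.singleFunctor _ 0).obj M))
    (hom_single_shift_eq_zero hP.1.2.2 M h₀ h₁) A hA
  have hRM (g : ModuleCat.of R R ⟶ M) : g = 0 := by
    apply (DerivedCategory.singleFunctor (ModuleCat.{0} R) 0).map_injective
    rw [Functor.map_zero]
    exact (Preadditive.IsIso.comp_right_eq_zero _ ((shiftFunctorZero _ ℤ).app _).inv).1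
      (hAM 0 ((DerivedCategory.singleFunctor (ModuleCat.{0} R) 0).map g ≫
        ((shiftFunctorZero _ ℤ).app _).inv))
  have : Subsingleton M := ⟨fun x y ↦ by
    have hx (x : M) : x = 0 := by
      simpa using ConcreteCategory.congr_hom
        (hRM (ModuleCat.ofHom (LinearMap.toSpanSingleton R M x))) (1 : R)
    rw [hx x, hx y]⟩
  exact ModuleCat.isZero_of_subsingleton M

/-- For a 2-term silting complex `P` and an object `X` of `D = D^b(A)`,
`X ∈ C(P)` iff `H^0(X) ∈ T(P)`, `H^{-1}(X) ∈ F(P)` and `H^i(X) = 0` for `i ≠ -1, 0`. -/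
theorem mem_CP_iff_homology
    (k A : Type) [Field k] [Ring A] [Algebra k A] [FiniteDimensional k A]
    [HasDerivedCategory.{w} (ModuleCat.{0} Aᵐᵒᵖ)]
    (P : CochainComplex (ModuleCat.{0} Aᵐᵒᵖ) ℤ)
    (hP : IsTwoTermSilting Aᵐᵒᵖ P)
    (X : DerivedCategory (ModuleCat.{0} Aᵐᵒᵖ)) (hX : InDb Aᵐᵒᵖ X) :
    X ∈ CP P ↔
      ((DerivedCategory.homologyFunctor (ModuleCat.{0} Aᵐᵒᵖ) 0).obj X ∈ TT P ∧
       (DerivedCategory.homologyFunctor (ModuleCat.{0} Aᵐᵒᵖ) (-1)).obj X ∈ FF P ∧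
       ∀ i : ℤ, i ≠ -1 → i ≠ 0 →
         IsZero ((DerivedCategory.homologyFunctor (ModuleCat.{0} Aᵐᵒᵖ) i).obj X)) := by
  have := hP.1.1
  have hK := hP.1.2.2
  have hfin := hX.2
  constructor
  · rintro ⟨-, H⟩
    have H' (n : ℤ) (hn : n ≠ 0) := (hom_shift_eq_zero_iff_s7 hK X (n - 1) n (by lia)).1 (H n hn)
    refine ⟨⟨hfin _, (H' 1 (by lia)).1⟩, ⟨hfin _, (H' (-1) (by lia)).2⟩, fun i hi₁ hi₀ ↦ ?_⟩
    exact isZero_of_hom_silting_eq_zero hP _ (H' i hi₀).2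
      ((hom_shift_eq_zero_iff_s7 hK X i (i + 1) rfl).1 (H (i + 1) (by lia))).1
  · rintro ⟨⟨-, h₀⟩, ⟨-, h₁⟩, hz⟩
    refine ⟨hX, fun n hn ↦ (hom_shift_eq_zero_iff_s7 hK X (n - 1) n (by lia)).2 ⟨?_, ?_⟩⟩
    · by_cases h : n = 1
      · subst h
        exact h₀
      · exact fun f ↦ (Functor.map_isZero _ (Functor.map_isZero _
          (hz (n - 1) (by lia) (by lia)))).eq_of_tgt _ _
    · by_cases h : n = -1
      · subst h
        exact h₁
      · exact fun f ↦ (Functor.map_isZero _ (hz n h hn)).eq_of_tgt _ _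

end

end TwoTermSilting
end

section
/- Let A have finite global dimension d and let P be a 2-term silting complex in K^b(proj A). Then C(P) ⊆ 𝒫 * 𝒫[1] * ... * 𝒫[d+1], where 𝒫 = add P. -/
/-!
Common setup: we model right `A`-modules as `ModuleCat Aᵐᵒᵖ`, the bounded derived
category `D^b(mod A)` as the full subcategory (given by the predicate `InDb`) of the
derived category of `Mod Aᵐᵒᵖ` consisting of cohomologically bounded complexes with
finitely generated cohomology, and `K^b(proj A)` via bounded complexes of finitely
generated projective modules (`IsPerfCplx`).
-/

namespace TwoTermSilting

open CategoryTheory Limits Pretriangulated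

universe w v u

noncomputable section

section Shift

variable {C : Type u} [Category.{v} C] [HasShift C ℤ]

lemma shift_mem_shiftSet {S : Set C} {a b c : ℤ} (h : a + b = c) {X : C} (hX : X ∈ shiftSet S a) :
    X⟦b⟧ ∈ shiftSet S c := by
  obtain ⟨Y, hY, ⟨e⟩⟩ := hX
  exact ⟨Y, hY, ⟨(shiftFunctor C b).mapIso e ≪≫ ((shiftFunctorAdd' C a b c h).app Y).symm⟩⟩

variable [Preadditive C]

/-- All morphisms `U ⟶ V⟦n⟧` vanish. -/
def HomVan (U V : C) (n : ℤ) : Prop := ∀ f : U ⟶ V⟦n⟧, f = 0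

namespace HomVan

variable {U V : C}

lemma of_iso_right {V' : C} {n n' : ℤ} (h : HomVan U V n) (e : V⟦n⟧ ≅ V'⟦n'⟧) :
    HomVan U V' n' := fun f => by
  rw [← cancel_mono e.inv, h (f ≫ e.inv), zero_comp]

lemma of_retract_left {U' : C} {n : ℤ} (h : HomVan U V n) (i : U' ⟶ U) (r : U ⟶ U')
    (hir : i ≫ r = 𝟙 U') : HomVan U' V n := fun f => by
  rw [← Category.id_comp f, ← hir, Category.assoc, h (r ≫ f), comp_zero]

lemma of_iso_left {U' : C} {n : ℤ} (h : HomVan U V n) (e : U ≅ U') : HomVan U' V n :=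
  h.of_retract_left e.inv e.hom e.inv_hom_id

lemma shift_right_iff {a b c : ℤ} (h : a + b = c) : HomVan U (V⟦a⟧) b ↔ HomVan U V c :=
  ⟨fun H => H.of_iso_right ((shiftFunctorAdd' C a b c h).app V).symm,
    fun H => H.of_iso_right ((shiftFunctorAdd' C a b c h).app V)⟩

variable [∀ n : ℤ, (shiftFunctor C n).Additive]

lemma shift_left_iff {a b c : ℤ} (h : b + a = c) : HomVan (U⟦a⟧) V c ↔ HomVan U V b := by
  let e := (shiftFunctorAdd' C b a c h).app V
  constructor
  · intro H f
    apply (shiftFunctor C a).map_injective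
    rw [Functor.map_zero, ← cancel_mono e.inv, zero_comp]
    exact H _
  · intro H f
    obtain ⟨g, hg⟩ := (shiftFunctor C a).map_surjective (f ≫ e.hom)
    rw [← cancel_mono e.hom, ← hg, H g, Functor.map_zero, zero_comp]

end HomVan

end Shift

section Star

variable {C : Type u} [Category.{v} C] [HasZeroObject C] [Preadditive C] [HasShift C ℤ]
  [∀ n : ℤ, (shiftFunctor C n).Additive] [Pretriangulated C]

lemma star_mono {S S' T T' : Set C} (hS : S ⊆ S') (hT : T ⊆ T') : star S T ⊆ star S' T' := by
  rintro Z ⟨X, Y, f, g, h, hX, hY, hT'⟩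
  exact ⟨X, Y, f, g, h, hS hX, hT hY, hT'⟩

lemma star_eq_extensionProduct (S T : Set C) :
    star S T = {Z | ObjectProperty.extensionProduct (· ∈ S) (· ∈ T) Z} := by
  ext Z
  constructor
  · rintro ⟨X, Y, f, g, h, hX, hY, hT⟩
    exact ⟨X, Y, f, g, h, hT, hX, hY⟩
  · rintro ⟨X, Y, f, g, h, hT, hX, hY⟩
    exact ⟨X, Y, f, g, h, hX, hY, hT⟩

lemma star_assoc [IsTriangulated C] (S T U : Set C) :
    star (star S T) U = star S (star T U) := by
  simp only [star_eq_extensionProduct]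
  exact ObjectProperty.extensionProduct_assoc _ _ _

lemma shift_mem_star {S S' T T' : Set C} (n : ℤ) (hS : ∀ X ∈ S, X⟦n⟧ ∈ S')
    (hT : ∀ X ∈ T, X⟦n⟧ ∈ T') {Z : C} (hZ : Z ∈ star S T) : Z⟦n⟧ ∈ star S' T' := by
  obtain ⟨X, Y, f, g, h, hX, hY, hd⟩ := hZ
  exact ⟨_, _, _, _, _, hS X hX, hT Y hY, Triangle.shift_distinguished _ hd n⟩

lemma shift_mem_starChain {f g : ℕ → Set C} (n : ℤ) (h : ∀ i, ∀ X ∈ f i, X⟦n⟧ ∈ g i) (m : ℕ)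
    {X : C} (hX : X ∈ starChain f m) : X⟦n⟧ ∈ starChain g m := by
  induction m generalizing X with
  | zero => exact h 0 X hX
  | succ m ih => exact shift_mem_star n (fun _ => ih) (h (m + 1)) hX

lemma star_starChain_subset [IsTriangulated C] {S : Set C} {f g : ℕ → Set C} (hS : S ⊆ f 0)
    (h : ∀ i, g i ⊆ f (i + 1)) (m : ℕ) : star S (starChain g m) ⊆ starChain f (m + 1) := by
  induction m with
  | zero => exact star_mono hS (h 0)
  | succ m ih =>
    refine subset_trans ?_ (star_mono ih (h (m + 1)))
    rw [star_assoc]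
    exact subset_rfl

namespace HomVan

variable {U V : C}

lemma biproduct_left {n : ℤ} {m : ℕ} (h : HomVan U V n) :
    HomVan (⨁ (fun _ : Fin m => U)) V n := fun f => by
  refine biproduct.hom_ext' _ _ fun j => ?_
  rw [comp_zero]
  exact h _

lemma biproduct_right {n : ℤ} {m : ℕ} (h : HomVan U V n) :
    HomVan U (⨁ (fun _ : Fin m => V)) n := fun f => by
  have H : 𝟙 (⨁ (fun _ : Fin m => V)) = ∑ j, biproduct.π _ j ≫ biproduct.ι _ j :=
    biproduct.total.symm
  have : f = f ≫ (𝟙 (⨁ (fun _ : Fin m => V)))⟦n⟧' := by simp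
  rw [this, H, Functor.map_sum, Preadditive.comp_sum]
  refine Finset.sum_eq_zero fun j _ => ?_
  rw [Functor.map_comp, ← Category.assoc, h (f ≫ _), zero_comp]

section

variable {T : Triangle C} (hT : T ∈ distTriang C)

include hT

lemma right_two {n : ℤ} (h₁ : HomVan U T.obj₁ n) (h₃ : HomVan U T.obj₃ n) :
    HomVan U T.obj₂ n := fun f => by
  obtain ⟨g, hg⟩ := Triangle.coyoneda_exact₂ _ (Triangle.shift_distinguished _ hT n) f (h₃ _)
  rw [hg, h₁ g]
  exact zero_comp

lemma right_three {n m : ℤ} (hnm : n + 1 = m) (h₂ : HomVan U T.obj₂ n) (h₁ : HomVan U T.obj₁ m) :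
    HomVan U T.obj₃ n :=
  right_two (rot_of_distTriang _ hT) h₂ ((shift_right_iff (by lia)).2 h₁)

lemma right_one {n m : ℤ} (hnm : n + 1 = m) (h₃ : HomVan U T.obj₃ n) (h₂ : HomVan U T.obj₂ m) :
    HomVan U T.obj₁ m :=
  right_two (inv_rot_of_distTriang _ hT) ((shift_right_iff (by lia)).2 h₃) h₂

lemma left_two {n : ℤ} (h₁ : HomVan T.obj₁ V n) (h₃ : HomVan T.obj₃ V n) :
    HomVan T.obj₂ V n := fun f => by
  obtain ⟨g, hg⟩ := Triangle.yoneda_exact₂ _ hT f (h₁ _)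
  rw [hg, h₃ g, comp_zero]

lemma left_three {n m : ℤ} (hnm : n + 1 = m) (h₁ : HomVan T.obj₁ V n) (h₂ : HomVan T.obj₂ V m) :
    HomVan T.obj₃ V m :=
  left_two (rot_of_distTriang _ hT) h₂ ((shift_left_iff hnm).2 h₁)

lemma left_one {n m : ℤ} (hnm : n + 1 = m) (h₂ : HomVan T.obj₂ V n) (h₃ : HomVan T.obj₃ V m) :
    HomVan T.obj₁ V n :=
  left_two (inv_rot_of_distTriang _ hT) ((shift_left_iff (by lia)).2 h₃) h₂

end

end HomVan

lemma biproduct_mem_shiftSet_addOf (P : C) (m : ℕ) :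
    (⨁ (fun _ : Fin m => P)) ∈ shiftSet (addOf P) 0 :=
  ⟨_, ⟨m, 𝟙 _, 𝟙 _, Category.id_comp _⟩, ⟨((shiftFunctorZero C ℤ).app _).symm⟩⟩

lemma mem_starChain_of_approx [IsTriangulated C] (P : C) (E : C → Prop)
    (happrox : ∀ X, E X → ∃ (m : ℕ) (Y : C) (f : Y ⟶ ⨁ (fun _ : Fin m => P))
      (g : (⨁ (fun _ : Fin m => P)) ⟶ X) (h : X ⟶ Y⟦(1 : ℤ)⟧),
      E Y ∧ Triangle.mk f g h ∈ distTriang C)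
    (hvan : ∀ X, E X → ∀ i : ℤ, 0 < i → HomVan P X i) (n : ℕ) (X : C) (hX : E X)
    (hXn : ∀ Y, E Y → HomVan X Y (n + 1)) :
    X ∈ starChain (fun i => shiftSet (addOf P) (i : ℤ)) n := by
  induction n generalizing X with
  | zero =>
    obtain ⟨m, Y, f, g, h, hY, hT⟩ := happrox X hX
    have h0 : h = 0 := hXn Y hY h
    obtain ⟨s, hs⟩ := Triangle.coyoneda_exact₃ _ hT (𝟙 X) ((Category.id_comp h).trans h0)
    exact ⟨X, ⟨m, s, g, hs.symm⟩, ⟨((shiftFunctorZero C ℤ).app _).symm⟩⟩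
  | succ n ih =>
    obtain ⟨m, Y, f, g, h, hY, hT⟩ := happrox X hX
    have hYn : Y ∈ starChain (fun i => shiftSet (addOf P) (i : ℤ)) n := by
      refine ih Y hY fun Z hZ => ?_
      refine HomVan.left_one hT (m := (n : ℤ) + 1 + 1) rfl ?_ ?_
      · exact (hvan Z hZ _ (by positivity)).biproduct_left
      · simpa using hXn Z hZ
    refine star_starChain_subset (g := fun i => shiftSet (addOf P) ((i : ℤ) + 1)) ?_ ?_ n
      ⟨_, _, _, _, _, biproduct_mem_shiftSet_addOf P m, ?_, rot_of_distTriang _ hT⟩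
    · simp
    · intro i
      simp
    · exact shift_mem_starChain 1 (fun i Z hZ => shift_mem_shiftSet rfl hZ) n hYn

end Star

section Finiteness

variable (k : Type*) [Field k] {C : Type u} [Category.{v} C] [Preadditive C] [Linear k C]

lemma finite_hom_of_iso {X Y Z : C} [Module.Finite k (X ⟶ Y)] (e : Y ≅ Z) :
    Module.Finite k (X ⟶ Z) :=
  Module.Finite.of_surjective (Linear.rightComp k X e.hom) fun f => ⟨f ≫ e.inv, by simp⟩

lemma finite_hom_of_exact {U X Y Z : C} (f : X ⟶ Y) (g : Y ⟶ Z)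
    (h : ∀ u : U ⟶ Y, u ≫ g = 0 → ∃ v : U ⟶ X, u = v ≫ f)
    [Module.Finite k (U ⟶ X)] [Module.Finite k (U ⟶ Z)] : Module.Finite k (U ⟶ Y) := by
  let F := Linear.rightComp k U f
  let G := Linear.rightComp k U g
  have hFG : LinearMap.ker G ≤ LinearMap.range F := fun u hu => by
    obtain ⟨v, hv⟩ := h u hu
    exact ⟨v, hv.symm⟩
  have h₁ : (LinearMap.ker G).FG := by
    have : Module.Finite k (LinearMap.ker G) :=
      Submodule.finiteDimensional_of_le hFG
    exact Module.Finite.iff_fg.1 this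
  have h₂ : (Submodule.map G ⊤).FG := IsNoetherian.noetherian _
  exact ⟨Submodule.fg_of_fg_map_of_fg_inf_ker G h₂ (by simpa using h₁)⟩

lemma exists_right_approximation (P X : C) [HasFiniteBiproducts C] [Module.Finite k (P ⟶ X)] :
    ∃ (m : ℕ) (φ : (⨁ (fun _ : Fin m => P)) ⟶ X), ∀ f : P ⟶ X, ∃ g, f = g ≫ φ := by
  obtain ⟨m, s, hs⟩ := Module.Finite.exists_fin (R := k) (M := P ⟶ X)
  refine ⟨m, biproduct.desc s, fun f => ?_⟩
  obtain ⟨c, rfl⟩ := (Submodule.mem_span_range_iff_exists_fun k).1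
    (hs ▸ Submodule.mem_top : f ∈ Submodule.span k (Set.range s))
  exact ⟨biproduct.lift fun i => c i • 𝟙 P, by simp [biproduct.lift_desc]⟩

variable [HasShift C ℤ]

/-- All the spaces of morphisms `U ⟶ V⟦n⟧` are finite dimensional over `k`. -/
def HomFinite (U V : C) : Prop := ∀ n : ℤ, Module.Finite k (U ⟶ V⟦n⟧)

variable {k} {U V : C}

namespace HomFinite

lemma of_iso {V' : C} (h : HomFinite k U V) (e : V ≅ V') : HomFinite k U V' := fun n => by
  have := h n
  exact finite_hom_of_iso k ((shiftFunctor C n).mapIso e)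

lemma shift (h : HomFinite k U V) (a : ℤ) : HomFinite k U (V⟦a⟧) := fun n => by
  have := h (a + n)
  exact finite_hom_of_iso k ((shiftFunctorAdd C a n).app V)

end HomFinite

end Finiteness

section FiniteTriangle

variable (k : Type*) [Field k] {C : Type u} [Category.{v} C] [HasZeroObject C] [Preadditive C]
  [HasShift C ℤ] [∀ n : ℤ, (shiftFunctor C n).Additive] [Pretriangulated C] [Linear k C]

variable {k} {U V : C}

namespace HomFinite

lemma biproduct (h : HomFinite k U V) (m : ℕ) : HomFinite k U (⨁ (fun _ : Fin m => V)) :=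
    fun n => by
  have := h n
  let F : (Fin m → (U ⟶ V⟦n⟧)) →ₗ[k] (U ⟶ (⨁ (fun _ : Fin m => V))⟦n⟧) :=
    ∑ j, (Linear.rightComp k U ((biproduct.ι (fun _ : Fin m => V) j)⟦n⟧')).comp (LinearMap.proj j)
  refine Module.Finite.of_surjective F fun f =>
    ⟨fun j => f ≫ (biproduct.π (fun _ : Fin m => V) j)⟦n⟧', ?_⟩
  simp [F, ← Functor.map_comp, ← Preadditive.comp_sum, ← Functor.map_sum, biproduct.total]

lemma two {T : Triangle C} (hT : T ∈ distTriang C) (h₁ : HomFinite k U T.obj₁)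
    (h₃ : HomFinite k U T.obj₃) : HomFinite k U T.obj₂ := fun n => by
  have := h₁ n
  have := h₃ n
  have hT' := Triangle.shift_distinguished _ hT n
  let T' := (Triangle.shiftFunctor C n).obj T
  have : Module.Finite k (U ⟶ T'.obj₁) := h₁ n
  have : Module.Finite k (U ⟶ T'.obj₃) := h₃ n
  exact finite_hom_of_exact k (X := T'.obj₁) (Y := T'.obj₂) (Z := T'.obj₃)
    T'.mor₁ T'.mor₂ fun u hu => Triangle.coyoneda_exact₂ _ hT' u hu

lemma one {T : Triangle C} (hT : T ∈ distTriang C) (h₂ : HomFinite k U T.obj₂)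
    (h₃ : HomFinite k U T.obj₃) : HomFinite k U T.obj₁ :=
  two (inv_rot_of_distTriang _ hT) (h₃.shift (-1)) h₂

end HomFinite

end FiniteTriangle

section Derived

open DerivedCategory DerivedCategory.TStructure

section Abelian

lemma projective_single_X {C : Type u} [Category.{v} C] [Abelian C] (M : C) [Projective M] (i : ℤ) :
    Projective (((CochainComplex.singleFunctor C 0).obj M).X i) := by
  by_cases hi : i = 0
  · subst hi
    exact Projective.of_iso (HomologicalComplex.singleObjXSelf (ComplexShape.up ℤ) 0 M).symm
      inferInstance
  · exact Projective.of_iso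
      (HomologicalComplex.isZero_single_obj_X (ComplexShape.up ℤ) 0 M i hi).isoZero.symm
      inferInstance

variable {C : Type u} [Category.{v} C] [Abelian C] [HasDerivedCategory.{w} C]

lemma isLE_two {T : Triangle (DerivedCategory C)} (hT : T ∈ distTriang _) (n : ℤ)
    (h₁ : T.obj₁.IsLE n) (h₃ : T.obj₃.IsLE n) : T.obj₂.IsLE n := by
  rw [isLE_iff] at *
  exact fun i hi => (HomologySequence.exact₂ T hT i).isZero_of_both_zeros
    ((h₁ i hi).eq_of_src _ _) ((h₃ i hi).eq_of_tgt _ _)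

lemma isGE_two {T : Triangle (DerivedCategory C)} (hT : T ∈ distTriang _) (n : ℤ)
    (h₁ : T.obj₁.IsGE n) (h₃ : T.obj₃.IsGE n) : T.obj₂.IsGE n := by
  rw [isGE_iff] at *
  exact fun i hi => (HomologySequence.exact₂ T hT i).isZero_of_both_zeros
    ((h₁ i hi).eq_of_src _ _) ((h₃ i hi).eq_of_tgt _ _)

lemma isLE_one {T : Triangle (DerivedCategory C)} (hT : T ∈ distTriang _) {n m : ℤ} (h : n + 1 ≤ m)
    (h₂ : T.obj₂.IsLE m) (h₃ : T.obj₃.IsLE n) : T.obj₁.IsLE m := by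
  refine isLE_two (inv_rot_of_distTriang _ hT) m ?_ h₂
  have : (T.obj₃⟦(-1 : ℤ)⟧).IsLE (n + 1) := t.isLE_shift _ n (-1) (n + 1)
  exact t.isLE_of_le (T.obj₃⟦(-1 : ℤ)⟧) (n + 1) m h

lemma isGE_one {T : Triangle (DerivedCategory C)} (hT : T ∈ distTriang _) {n m : ℤ} (h : m ≤ n + 1)
    (h₂ : T.obj₂.IsGE m) (h₃ : T.obj₃.IsGE n) : T.obj₁.IsGE m := by
  refine isGE_two (inv_rot_of_distTriang _ hT) m ?_ h₂
  have : (T.obj₃⟦(-1 : ℤ)⟧).IsGE (n + 1) := t.isGE_shift _ n (-1) (n + 1)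
  exact t.isGE_of_ge (T.obj₃⟦(-1 : ℤ)⟧) m (n + 1) h

lemma isLE_three {T : Triangle (DerivedCategory C)} (hT : T ∈ distTriang _) {n m : ℤ}
    (h : n ≤ m + 1) (h₁ : T.obj₁.IsLE n) (h₂ : T.obj₂.IsLE m) : T.obj₃.IsLE m := by
  refine isLE_two (rot_of_distTriang _ hT) m h₂ ?_
  have : (T.obj₁⟦(1 : ℤ)⟧).IsLE (n - 1) := t.isLE_shift _ n 1 (n - 1)
  exact t.isLE_of_le (T.obj₁⟦(1 : ℤ)⟧) (n - 1) m (by lia)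

lemma homVan_of_isLE_of_isGE {U V : DerivedCategory C} {a b n : ℤ} (hU : U.IsLE a)
    (hV : V.IsGE b) (h : a + n < b) : HomVan U V n := fun f => by
  have := t.isGE_shift V b n (b - n)
  exact t.zero f a (b - n) (by lia)

lemma Q_map_surjective (K L : CochainComplex C ℤ) [K.IsKProjective] :
    Function.Surjective (Q.map : (K ⟶ L) → (Q.obj K ⟶ Q.obj L)) := fun f => by
  obtain ⟨g, hg⟩ := (CochainComplex.IsKProjective.Qh_map_bijective K
    ((HomotopyCategory.quotient _ _).obj L)).2
      ((quotientCompQhIso C).hom.app K ≫ f ≫ (quotientCompQhIso C).inv.app L)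
  obtain ⟨g, rfl⟩ := (HomotopyCategory.quotient _ _).map_surjective g
  refine ⟨g, ?_⟩
  have := (quotientCompQhIso C).hom.naturality g
  rw [← cancel_epi ((quotientCompQhIso C).hom.app K), ← this]
  erw [hg]
  simp

lemma homVan_Q_of_isLE (K : CochainComplex C ℤ) [K.IsKProjective] {V : DerivedCategory C}
    {a b n : ℤ} [K.IsStrictlyGE a] (hV : V.IsLE b) (h : b < a + n) : HomVan (Q.obj K) V n :=
    fun f => by
  have := t.isLE_shift V b n (b - n)
  obtain ⟨L, _, ⟨e⟩⟩ := (V⟦n⟧).exists_iso_Q_obj_of_isLE (b - n)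
  obtain ⟨g, hg⟩ := Q_map_surjective K L (f ≫ e.hom)
  have hg0 : g = 0 := by
    ext i
    by_cases hi : i < a
    · exact (K.isZero_of_isStrictlyGE a i hi).eq_of_src _ _
    · exact (L.isZero_of_isStrictlyLE (b - n) i (by lia)).eq_of_tgt _ _
  rw [← cancel_mono e.hom, ← hg, hg0, Functor.map_zero, zero_comp]

/-- The single complexes in various degrees are shifts of each other. -/
def singleShiftIso (M : C) (n : ℤ) :
    ((singleFunctor C n).obj M)⟦n⟧ ≅ (singleFunctor C 0).obj M :=
  ((singleFunctors C).shiftIso n 0 n (by simp)).app M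

lemma homVan_single_of_projective (M : C) [Projective M] {V : DerivedCategory C} {b n : ℤ}
    (hV : V.IsLE b) (h : b < n) : HomVan ((singleFunctor C 0).obj M) V n := by
  let K := (CochainComplex.singleFunctor C 0).obj M
  have := projective_single_X M
  have := CochainComplex.isKProjective_of_projective K 0
  exact (homVan_Q_of_isLE K (a := 0) hV (by lia)).of_iso_left ((singleFunctorIsoCompQ C 0).app M).symm

end Abelian

section Modules

variable {R : Type u} [Ring R] [HasDerivedCategory.{w} (ModuleCat.{v} R)]

lemma homVan_single_of_pdLE (d : ℕ) (M : ModuleCat.{v} R) (hM : pdLE R d M)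
    {V : DerivedCategory (ModuleCat.{v} R)} {b n : ℤ} (hV : V.IsLE b) (h : b + d < n) :
    HomVan ((singleFunctor _ 0).obj M) V n := by
  induction d generalizing M n with
  | zero =>
    have : Projective M := hM
    exact homVan_single_of_projective M hV (by simpa using h)
  | succ d ih =>
    obtain ⟨P, f, hP, hf, hK⟩ := hM
    have hS : (ShortComplex.mk (kernel.ι f) f (kernel.condition f)).ShortExact :=
      { exact := ShortComplex.exact_kernel f }
    exact HomVan.left_three hS.singleTriangle_distinguished (n := n - 1) (by lia)
      (ih _ hK (by push_cast at h; lia)) (homVan_single_of_projective P hV (by push_cast at h; lia))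

lemma exists_truncation_triangle {X : DerivedCategory (ModuleCat.{v} R)} (h₁ : X.IsLE 0)
    (h₂ : X.IsGE (-1)) [IsNoetherianRing R]
    (hX : ∀ i, Module.Finite R ((homologyFunctor (ModuleCat.{v} R) i).obj X)) :
    ∃ (M N : ModuleCat.{v} R) (T : Triangle (DerivedCategory (ModuleCat.{v} R)))
      (_ : T.obj₁ ≅ ((singleFunctor _ 0).obj M)⟦(1 : ℤ)⟧) (_ : T.obj₂ ≅ X)
      (_ : T.obj₃ ≅ (singleFunctor _ 0).obj N),
      Module.Finite R M ∧ Module.Finite R N ∧ T ∈ distTriang _ := by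
  obtain ⟨L, G, hL, hG, f, g, h, hT⟩ := t.exists_triangle X (-1) 0 rfl
  have hL : L.IsLE (-1) := ⟨hL⟩
  have hG : G.IsGE 0 := ⟨hG⟩
  have hL' : L.IsGE (-1) := isGE_one hT (n := 0) (by lia) h₂ hG
  have hG' : G.IsLE 0 := isLE_three hT (n := -1) (by lia) hL h₁
  obtain ⟨M, ⟨eM⟩⟩ := exists_iso_singleFunctor_obj_of_isGE_of_isLE L (-1)
  obtain ⟨N, ⟨eN⟩⟩ := exists_iso_singleFunctor_obj_of_isGE_of_isLE G 0
  refine ⟨M, N, _, eM ≪≫ (((singleFunctors _).shiftIso 1 (-1) 0 (by simp)).app M).symm,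
    Iso.refl _, eN, ?_, ?_, hT⟩
  · have := hX (-1)
    have : Mono ((homologyFunctor (ModuleCat.{v} R) (-1)).map f) := by
      refine (HomologySequence.mono_homologyMap_mor₁_iff _ hT (-2) (-1)).2 ?_
      exact (isGE_iff _ _ |>.1 hG _ (by lia)).eq_of_src _ _
    have := Module.Finite.of_injective ((homologyFunctor (ModuleCat.{v} R) (-1)).map f).hom
      ((ModuleCat.mono_iff_injective _).1 this)
    exact Module.Finite.equiv ((homologyFunctor _ (-1)).mapIso eM ≪≫
      (singleFunctorCompHomologyFunctorIso _ (-1)).app M).toLinearEquiv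
  · have := hX 0
    have : Epi ((homologyFunctor (ModuleCat.{v} R) 0).map g) := by
      refine (HomologySequence.epi_homologyMap_mor₂_iff _ hT 0 1).2 ?_
      exact (isLE_iff _ _ |>.1 hL _ (by lia)).eq_of_tgt _ _
    have := Module.Finite.of_surjective ((homologyFunctor (ModuleCat.{v} R) 0).map g).hom
      ((ModuleCat.epi_iff_surjective _).1 this)
    exact Module.Finite.equiv ((homologyFunctor _ 0).mapIso eN ≪≫
      (singleFunctorCompHomologyFunctorIso _ 0).app N).toLinearEquiv

end Modules

section Silting

lemma isZero_map_biproduct {C : Type*} [Category* C] [Preadditive C] [HasFiniteBiproducts C]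
    {D : Type*} [Category* D] [Preadditive D] (F : C ⥤ D) [F.Additive] {X : C} (m : ℕ)
    (h : IsZero (F.obj X)) : IsZero (F.obj (⨁ (fun _ : Fin m => X))) := by
  rw [IsZero.iff_id_eq_zero, ← F.map_id]
  have H : 𝟙 (⨁ (fun _ : Fin m => X)) = ∑ j, biproduct.π _ j ≫ biproduct.ι _ j :=
    biproduct.total.symm
  rw [H, F.map_sum]
  refine Finset.sum_eq_zero fun j _ => ?_
  rw [F.map_comp, h.eq_of_tgt (F.map _) 0, zero_comp]

variable {R : Type} [Ring R]

namespace IsTwoTermCplx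

variable {P : CochainComplex (ModuleCat.{0} R) ℤ} (hP : IsTwoTermCplx R P)

include hP

lemma isStrictlyLE : P.IsStrictlyLE 0 :=
  (CochainComplex.isStrictlyLE_iff _ _).2 fun i hi => hP.2.2 i (by lia) (by lia)

lemma isStrictlyGE : P.IsStrictlyGE (-1) :=
  (CochainComplex.isStrictlyGE_iff _ _).2 fun i hi => hP.2.2 i (by lia) (by lia)

lemma isKProjective_s12 : P.IsKProjective := by
  have := hP.isStrictlyLE
  have := hP.1
  exact CochainComplex.isKProjective_of_projective P 0

variable [HasDerivedCategory.{w} (ModuleCat.{0} R)]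

lemma isLE_Q : (Q.obj P).IsLE 0 := by
  have := hP.isStrictlyLE
  infer_instance

lemma homVan_of_isLE {V : DerivedCategory (ModuleCat.{0} R)} {b n : ℤ} (hV : V.IsLE b)
    (h : b + 1 < n) : HomVan (Q.obj P) V n := by
  have := hP.isStrictlyGE
  have := hP.isKProjective_s12
  exact homVan_Q_of_isLE P (a := -1) hV (by lia)

lemma homVan_of_isGE {V : DerivedCategory (ModuleCat.{0} R)} {b n : ℤ} (hV : V.IsGE b)
    (h : n < b) : HomVan (Q.obj P) V n :=
  homVan_of_isLE_of_isGE hP.isLE_Q hV (by lia)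

end IsTwoTermCplx

lemma finite_single_X (M : ModuleCat.{0} R) [Module.Finite R M] (i : ℤ) :
    Module.Finite R (((CochainComplex.singleFunctor (ModuleCat.{0} R) 0).obj M).X i) := by
  by_cases hi : i = 0
  · subst hi
    exact Module.Finite.equiv
      (HomologicalComplex.singleObjXSelf (ComplexShape.up ℤ) 0 M).symm.toLinearEquiv
  · have hz : IsZero (((CochainComplex.singleFunctor (ModuleCat.{0} R) 0).obj M).X i) :=
      HomologicalComplex.isZero_single_obj_X (ComplexShape.up ℤ) 0 M i hi
    have := ModuleCat.subsingleton_of_isZero hz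
    infer_instance

lemma isPerfCplx_single :
    IsPerfCplx R ((CochainComplex.singleFunctor (ModuleCat.{0} R) 0).obj (ModuleCat.of R R)) :=
  have : Projective (ModuleCat.of R R) := (IsProjective.iff_projective _).1 inferInstance
  ⟨projective_single_X _, finite_single_X _, 0, 0, fun i hi =>
    HomologicalComplex.isZero_single_obj_X (ComplexShape.up ℤ) 0 _ i (by lia)⟩

namespace IsTwoTermSilting

variable [HasDerivedCategory.{w} (ModuleCat.{0} R)]
  {P : CochainComplex (ModuleCat.{0} R) ℤ} (hP : IsTwoTermSilting R P)

include hP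

lemma isZero_of_homVan {V : DerivedCategory (ModuleCat.{0} R)} (n : ℤ) (h₁ : V.IsGE n)
    (h₂ : V.IsLE n) (h : ∀ i, HomVan (Q.obj P) V i) : IsZero V := by
  have hS : IsThick {Y : DerivedCategory (ModuleCat.{0} R) | ∀ i, HomVan Y V i} :=
    ⟨fun X Y e hX i => (hX i).of_iso_left e,
      fun X n hX i => (HomVan.shift_left_iff (sub_add_cancel i n)).2 (hX _),
      fun T hT h₁ h₃ i => HomVan.left_two hT (h₁ i) (h₃ i),
      fun X Y ι r hι hY i => (hY i).of_retract_left ι r hι⟩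
  have hR := hP.2.2 _ hS h _ isPerfCplx_single n
  obtain ⟨N, ⟨e⟩⟩ := exists_iso_singleFunctor_obj_of_isGE_of_isLE V n
  have hN : Subsingleton N := by
    refine ⟨fun x y => ?_⟩
    have key : ∀ x : N, x = 0 := fun x => by
      let m : ModuleCat.of R R ⟶ N := ModuleCat.ofHom (LinearMap.toSpanSingleton R N x)
      have hm : m = 0 := by
        apply (singleFunctor (ModuleCat.{0} R) 0).map_injective
        have H := hR ((singleFunctorIsoCompQ _ 0).inv.app (ModuleCat.of R R) ≫
          (singleFunctor (ModuleCat.{0} R) 0).map m ≫ (singleShiftIso N n).inv ≫ e.inv⟦n⟧')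
        simpa [← Functor.map_comp] using H
      have := congrArg (fun f => f.hom (1 : R)) hm
      simpa [m] using this
    rw [key x, key y]
  have hN' : IsZero N := ModuleCat.isZero_of_subsingleton N
  exact ((singleFunctor _ n).map_isZero hN').of_iso e

lemma isLE_zero (N : ℕ) {V : DerivedCategory (ModuleCat.{0} R)} (hV : V.IsLE N)
    (h : ∀ i : ℤ, 0 < i → HomVan (Q.obj P) V i) : V.IsLE 0 := by
  induction N with
  | zero => exact hV
  | succ N ih =>
    refine ih ?_
    obtain ⟨L, G, hL, hG, f, g, δ, hT⟩ := t.exists_triangle V N (N + 1) rfl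
    have hL : L.IsLE N := ⟨hL⟩
    have hG : G.IsGE (N + 1) := ⟨hG⟩
    have hG' : G.IsLE (N + 1) := isLE_three hT (n := N) (by lia) hL (by simpa using hV)
    have hz : IsZero G := hP.isZero_of_homVan (N + 1) hG hG' fun i => by
      by_cases hi : i < N + 1
      · exact hP.1.homVan_of_isGE hG hi
      · exact HomVan.right_three hT rfl (h i (by lia)) (hP.1.homVan_of_isLE hL (by lia))
    exact isLE_two hT _ hL ((isLE_iff _ _).2 fun i _ => (homologyFunctor _ i).map_isZero hz)

lemma isGE_neg_one (N : ℕ) {V : DerivedCategory (ModuleCat.{0} R)} (hV : V.IsGE (-1 - N))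
    (h : ∀ i : ℤ, i < 0 → HomVan (Q.obj P) V i) : V.IsGE (-1) := by
  induction N with
  | zero => simpa using hV
  | succ N ih =>
    refine ih ?_
    obtain ⟨L, G, hL, hG, f, g, δ, hT⟩ := t.exists_triangle V (-1 - (N + 1 : ℕ)) (-1 - N)
      (by push_cast; ring)
    have hL : L.IsLE (-1 - (N + 1 : ℕ)) := ⟨hL⟩
    have hG : G.IsGE (-1 - N) := ⟨hG⟩
    have hL' : L.IsGE (-1 - (N + 1 : ℕ)) := isGE_one hT (n := -1 - N) (by lia) hV hG
    have hz : IsZero L := hP.isZero_of_homVan _ hL' hL fun i => by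
      by_cases hi : i ≤ -1 - N
      · exact HomVan.right_one hT (sub_add_cancel i 1) (hP.1.homVan_of_isGE hG (by lia))
          (h i (by lia))
      · exact hP.1.homVan_of_isLE hL (by lia)
    exact isGE_two hT _ ((isGE_iff _ _).2 fun i _ => (homologyFunctor _ i).map_isZero hz) hG

lemma isLE_and_isGE_of_mem_CP {X : DerivedCategory (ModuleCat.{0} R)} (hX : X ∈ CP P) : X.IsLE 0 ∧ X.IsGE (-1) := by
  obtain ⟨⟨⟨a, b, hab⟩, -⟩, hv⟩ := hX
  exact ⟨hP.isLE_zero b.toNat ((isLE_iff _ _).2 fun i hi => hab i (by lia))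
      fun i hi => hv i (by lia),
    hP.isGE_neg_one (-a).toNat ((isGE_iff _ _).2 fun i hi => hab i (by lia))
      fun i hi => hv i (by lia)⟩

end IsTwoTermSilting

end Silting

section Finite

variable {k R : Type} [Field k] [Ring R] [Algebra k R] [FiniteDimensional k R]

open ModuleCat in
lemma finite_hom_moduleCat (M N : ModuleCat.{0} R) [Module.Finite R M] [Module.Finite R N] :
    Module.Finite k (M ⟶ N) := by
  have : Module.Finite k M := Module.Finite.trans R M
  have : Module.Finite k N := Module.Finite.trans R N
  let F : (M ⟶ N) →ₗ[k] (M →ₗ[k] N) :=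
    { toFun f := f.hom.restrictScalars k
      map_add' _ _ := rfl
      map_smul' _ _ := rfl }
  refine Module.Finite.of_injective F fun f g h => ?_
  ext x
  exact LinearMap.congr_fun h x

variable [HasDerivedCategory.{w} (ModuleCat.{0} R)] {P : CochainComplex (ModuleCat.{0} R) ℤ}

lemma IsTwoTermCplx.finite_hom_Q (hP : IsTwoTermCplx R P)
    (L : CochainComplex (ModuleCat.{0} R) ℤ) (hL : ∀ i, Module.Finite R (L.X i)) :
    Module.Finite k (Q.obj P ⟶ Q.obj L) := by
  have := hP.2.1
  have := hP.isKProjective_s12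
  have : ∀ i, Module.Finite k (P.X i ⟶ L.X i) := fun i => finite_hom_moduleCat _ _
  let F : (P ⟶ L) →ₗ[k] (P.X (-1) ⟶ L.X (-1)) × (P.X 0 ⟶ L.X 0) :=
    { toFun f := (f.f (-1), f.f 0)
      map_add' _ _ := rfl
      map_smul' _ _ := rfl }
  have : Module.Finite k (P ⟶ L) := by
    refine Module.Finite.of_injective F fun f g h => ?_
    ext1 i
    by_cases h₁ : i = -1
    · subst h₁
      exact congrArg Prod.fst h
    by_cases h₀ : i = 0
    · subst h₀
      exact congrArg Prod.snd h
    exact (hP.2.2 i h₁ h₀).eq_of_src _ _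
  exact Module.Finite.of_surjective (Q.mapLinearMap k (X := P) (Y := L)) (Q_map_surjective P L)

lemma IsTwoTermCplx.homFinite_Q (hP : IsTwoTermCplx R P)
    (L : CochainComplex (ModuleCat.{0} R) ℤ) (hL : ∀ i, Module.Finite R (L.X i)) :
    HomFinite k (Q.obj P) (Q.obj L) := fun n => by
  have : Module.Finite k (Q.obj P ⟶ (shiftFunctor _ n ⋙ Q).obj L) :=
    hP.finite_hom_Q (L⟦n⟧) fun i => hL (i + n)
  exact finite_hom_of_iso k ((Q.commShiftIso n).app L)

lemma IsTwoTermCplx.homFinite_single (hP : IsTwoTermCplx R P) (M : ModuleCat.{0} R)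
    [Module.Finite R M] : HomFinite k (Q.obj P) ((singleFunctor _ 0).obj M) := by
  exact (hP.homFinite_Q _ (finite_single_X M)).of_iso ((singleFunctorIsoCompQ _ 0).app M).symm

/-- The objects of the derived category which are bounded above, have no positive extensions
from `P`, and have finite-dimensional spaces of morphisms from all shifts of `P`. -/
def Approximable (k : Type) [Field k] [Algebra k R] (P : CochainComplex (ModuleCat.{0} R) ℤ)
    (X : DerivedCategory (ModuleCat.{0} R)) : Prop :=
  (∃ N : ℕ, X.IsLE N) ∧ (∀ i : ℤ, 0 < i → HomVan (Q.obj P) X i) ∧ HomFinite k (Q.obj P) X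

lemma IsTwoTermSilting.exists_approx (hP : IsTwoTermSilting R P)
    {X : DerivedCategory (ModuleCat.{0} R)} (hX : Approximable k P X) :
    ∃ (m : ℕ) (Y : DerivedCategory (ModuleCat.{0} R)) (f : Y ⟶ ⨁ (fun _ : Fin m => Q.obj P))
      (g : (⨁ (fun _ : Fin m => Q.obj P)) ⟶ X) (h : X ⟶ Y⟦(1 : ℤ)⟧),
      Approximable k P Y ∧ Triangle.mk f g h ∈ distTriang _ := by
  obtain ⟨⟨N, hN⟩, hXv, hXf⟩ := hX
  have := hXf 0
  have : Module.Finite k (Q.obj P ⟶ X) := finite_hom_of_iso k ((shiftFunctorZero _ ℤ).app X)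
  obtain ⟨m, φ, hφ⟩ := exists_right_approximation k (Q.obj P) X
  obtain ⟨Y, f, h, hT⟩ := distinguished_cocone_triangle₁ φ
  have hPv : ∀ i : ℤ, 0 < i → HomVan (Q.obj P) (⨁ (fun _ : Fin m => Q.obj P)) i := fun i hi => by
    refine HomVan.biproduct_right ?_
    by_cases h1 : i = 1
    · subst h1
      exact hP.2.1
    · exact hP.1.homVan_of_isLE hP.1.isLE_Q (by lia)
  have hPf : HomFinite k (Q.obj P) (⨁ (fun _ : Fin m => Q.obj P)) :=
    (hP.1.homFinite_Q P hP.1.2.1).biproduct m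
  have hPN : (⨁ (fun _ : Fin m => Q.obj P)).IsLE (N + 1 : ℕ) := (isLE_iff _ _).2 fun i hi =>
    isZero_map_biproduct (homologyFunctor _ i) m
      ((isLE_iff _ _).1 hP.1.isLE_Q i (by lia))
  refine ⟨m, Y, f, φ, h, ⟨⟨N + 1, isLE_one hT (n := N) (by lia) hPN hN⟩, fun i hi => ?_,
    HomFinite.one hT hPf hXf⟩, hT⟩
  by_cases h1 : i = 1
  · subst h1
    intro u
    obtain ⟨v, rfl⟩ := Triangle.coyoneda_exact₁ _ hT u (hPv 1 hi _)
    obtain ⟨w, rfl⟩ := hφ v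
    have : φ ≫ h = 0 := comp_distTriang_mor_zero₂₃ _ hT
    exact (Category.assoc _ _ _).trans ((congrArg (w ≫ ·) this).trans comp_zero)
  · exact HomVan.right_one hT (sub_add_cancel i 1) (hXv _ (by lia)) (hPv i hi)

end Finite

end Derived

/-- If `gl.dim A ≤ d` and `P` is a 2-term silting complex in
`K^b(proj A)`, then `C(P) ⊆ 𝒫 * 𝒫[1] * ⋯ * 𝒫[d+1]`, where `𝒫 = add P`. -/
theorem CP_subset_starChain_add
    (k A : Type) [Field k] [Ring A] [Algebra k A] [FiniteDimensional k A]
    [HasDerivedCategory.{w} (ModuleCat.{0} Aᵐᵒᵖ)]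
    (P : CochainComplex (ModuleCat.{0} Aᵐᵒᵖ) ℤ)
    (hP : IsTwoTermSilting Aᵐᵒᵖ P)
    (d : ℕ) (hgld : gldLE.{0, 0} Aᵐᵒᵖ d) :
    CP P ⊆ starChain
      (fun i => shiftSet (addOf (DerivedCategory.Q.obj P)) (i : ℤ)) (d + 1) := by
  intro X hX
  have : IsNoetherianRing Aᵐᵒᵖ := IsNoetherianRing.of_finite k Aᵐᵒᵖ
  obtain ⟨hXle, hXge⟩ := hP.isLE_and_isGE_of_mem_CP hX
  obtain ⟨M, N, T, e₁, e₂, e₃, hM, hN, hT⟩ := exists_truncation_triangle hXle hXge hX.1.2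
  have hXf : HomFinite k (DerivedCategory.Q.obj P) X :=
    (HomFinite.two hT (((hP.1.homFinite_single M).shift 1).of_iso e₁.symm)
      ((hP.1.homFinite_single N).of_iso e₃.symm)).of_iso e₂
  refine mem_starChain_of_approx _ (Approximable k P) (fun _ => hP.exists_approx)
    (fun _ hY => hY.2.1) (d + 1) X ⟨⟨0, hXle⟩, fun i hi => hX.2 i hi.ne', hXf⟩ fun Y hY => ?_
  obtain ⟨n, hn⟩ := hY.1
  have hY0 := hP.isLE_zero n hn hY.2.1
  refine (HomVan.left_two hT (HomVan.of_iso_left ?_ e₁.symm)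
    (HomVan.of_iso_left ?_ e₃.symm)).of_iso_left e₂
  · exact (HomVan.shift_left_iff rfl).2 (homVan_single_of_pdLE d M (hgld M hM) hY0 (by lia))
  · exact homVan_single_of_pdLE d N (hgld N hN) hY0 (by lia)

end

end TwoTermSilting
end
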